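/- arXiv:1209.4396 — 10 statements merged into one kernel-verified Lean document; each statement's English description precedes it below -/
import Mathlib

section
/- Let ℓ and p be distinct primes, let n ≥ 1, let F be a finite field with |F| = p^(2n), and let a ∈ F satisfy a^(p^n) = a. Let α ∈ Fˣ satisfy α + α⁻¹ = a, and write the multiplicative order of α as ℓ^k · d with ℓ ∤ d. Then the preperiod of a under the map f : F → F, f(x) = T_ℓ(x), equals k; that is, k is the least natural number ρ such that f^[ρ](a) is a periodic point of f. -/
open Polynomial Function

theorem iterate_dickson_one_one_eval_add_inv {F : Type*} [Field F] (l : ℕ) (α : Fˣ) (m : ℕ) :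
    (fun x : F => (dickson 1 (1 : F) l).eval x)^[m] ((α : F) + ((α⁻¹ : Fˣ) : F)) =
      ((α ^ l ^ m : Fˣ) : F) + (((α ^ l ^ m)⁻¹ : Fˣ) : F) := by
  induction m with
  | zero => simp
  | succ m ih =>
    rw [iterate_succ_apply', ih]
    rw [dickson_one_one_eval_add_inv _ _ (Units.mul_inv _), pow_succ, pow_mul]
    simp

theorem Units.eq_or_eq_inv_of_add_inv_eq {F : Type*} [Field F] {u v : Fˣ}
    (h : (u : F) + ((u⁻¹ : Fˣ) : F) = (v : F) + ((v⁻¹ : Fˣ) : F)) : u = v ∨ u = v⁻¹ := by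
  have hu : (u : F) * ((u⁻¹ : Fˣ) : F) = 1 := Units.mul_inv u
  have hv : (v : F) * ((v⁻¹ : Fˣ) : F) = 1 := Units.mul_inv v
  have key : ((u : F) - v) * ((u : F) - ((v⁻¹ : Fˣ) : F)) = 0 := by
    linear_combination (u : F) * h - hu + hv
  rcases mul_eq_zero.mp key with h | h
  · exact Or.inl (Units.ext (sub_eq_zero.mp h))
  · exact Or.inr (Units.ext (sub_eq_zero.mp h))

theorem exists_pow_prime_pow_eq_self {G : Type*} [Group G] {l d : ℕ} (hl : l.Prime)
    (hd : ¬ l ∣ d) {x : G} (hx : x ^ d = 1) : ∃ m > 0, x ^ l ^ m = x := by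
  have hd0 : d ≠ 0 := fun h => hd (h ▸ dvd_zero l)
  refine ⟨d.totient, Nat.totient_pos.mpr (Nat.pos_of_ne_zero hd0), ?_⟩
  have hmod : l ^ d.totient ≡ 1 [MOD d] :=
    Nat.ModEq.pow_totient ((Nat.Prime.coprime_iff_not_dvd hl).mpr hd)
  simpa using pow_eq_pow_iff_modEq.mpr (hmod.of_dvd (orderOf_dvd_of_pow_eq_one hx))

/-- Let ℓ and p be distinct primes, n ≥ 1, F a finite field of order
p^(2n), and a ∈ F with a^(p^n) = a.  If α ∈ Fˣ satisfies α + α⁻¹ = a and the order of α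
is ℓ^k·d with ℓ ∤ d, then the preperiod of a under x ↦ T_ℓ(x) is k: k is the least ρ
such that the ρ-th iterate of a is a periodic point. -/
theorem chebyshev_preperiod
    (ℓ p : ℕ) (hℓ : ℓ.Prime) (hp : p.Prime) (hℓp : ℓ ≠ p)
    (n : ℕ) (hn : 1 ≤ n)
    (F : Type*) [Field F] [Fintype F] (hF : Fintype.card F = p ^ (2 * n))
    (a : F) (ha : a ^ (p ^ n) = a)
    (α : Fˣ) (hα : (α : F) + ((α⁻¹ : Fˣ) : F) = a)
    (k d : ℕ) (hd : ¬ ℓ ∣ d) (hord : orderOf α = ℓ ^ k * d) :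
    IsLeast {ρ : ℕ | (fun x : F => (dickson 1 (1 : F) ℓ).eval x)^[ρ] a ∈
      periodicPts (fun x : F => (dickson 1 (1 : F) ℓ).eval x)} k := by
  subst hα
  have hiter := iterate_dickson_one_one_eval_add_inv (F := F) ℓ α
  constructor
  · have hβ : (α ^ ℓ ^ k) ^ d = 1 := by rw [← pow_mul, ← hord, pow_orderOf_eq_one]
    obtain ⟨m, hm, hper⟩ := exists_pow_prime_pow_eq_self hℓ hd hβ
    refine mk_mem_periodicPts hm ?_
    rw [IsPeriodicPt, IsFixedPt, ← iterate_add_apply, hiter, hiter, add_comm m k, pow_add,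
      pow_mul, hper]
  · rintro ρ ⟨m, hm, hper⟩
    rw [IsPeriodicPt, IsFixedPt, ← iterate_add_apply, hiter, hiter, add_comm m ρ, pow_add,
      pow_mul] at hper
    have heq : orderOf ((α ^ ℓ ^ ρ) ^ ℓ ^ m) = orderOf (α ^ ℓ ^ ρ) := by
      rcases Units.eq_or_eq_inv_of_add_inv_eq hper with h | h
      · rw [h]
      · rw [h, orderOf_inv]
    have hcop : ¬ ℓ ∣ orderOf (α ^ ℓ ^ ρ) := by
      intro hdvd
      have hg := Nat.dvd_gcd hdvd (dvd_pow_self ℓ hm.ne')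
      rw [orderOf_pow] at heq
      have hlt := Nat.div_lt_self (orderOf_pos (α ^ ℓ ^ ρ))
        (hℓ.one_lt.trans_le (Nat.le_of_dvd (Nat.gcd_pos_of_pos_left _ (orderOf_pos _)) hg))
      exact hlt.ne heq
    have hdvd : ℓ ^ k ∣ ℓ ^ ρ * orderOf (α ^ ℓ ^ ρ) := by
      refine (Dvd.intro d hord.symm).trans (orderOf_dvd_of_pow_eq_one ?_)
      rw [pow_mul, pow_orderOf_eq_one]
    exact (Nat.pow_dvd_pow_iff_le_right hℓ.one_lt).mp
      ((((Nat.Prime.coprime_iff_not_dvd hℓ).mpr hcop).pow_left k).dvd_of_dvd_mul_right hdvd)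
end

section
/- Let ℓ and p be distinct primes, let n ≥ 1, let F be a finite field with |F| = p^(2n), and let a ∈ F satisfy a^(p^n) = a. Let α ∈ Fˣ satisfy α + α⁻¹ = a, and write the multiplicative order of α as ℓ^k · d with ℓ ∤ d. Then the point b = f^[k](a), where f : F → F is f(x) = T_ℓ(x), is periodic under f with minimal period equal to c(d), the least integer π ≥ 1 such that ℓ^π ≡ 1 (mod d) or ℓ^π ≡ −1 (mod d). -/
open Polynomial Function

/-- In a field, `u + u⁻¹` determines the unit `u` up to inversion. -/
theorem Units.add_inv_eq_add_inv_iff {K : Type*} [Field K] (u v : Kˣ) :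
    (u : K) + ((u⁻¹ : Kˣ) : K) = v + ((v⁻¹ : Kˣ) : K) ↔ u = v ∨ u = v⁻¹ := by
  constructor
  · intro h
    have hu : (u : K) * ((u⁻¹ : Kˣ) : K) = 1 := u.mul_inv
    have hv : (v : K) * ((v⁻¹ : Kˣ) : K) = 1 := v.mul_inv
    have key : ((u : K) - v) * (u - ((v⁻¹ : Kˣ) : K)) = 0 := by
      linear_combination (u : K) * h - hu + hv
    rcases mul_eq_zero.mp key with h | h
    · exact Or.inl (Units.ext (sub_eq_zero.mp h))
    · exact Or.inr (Units.ext (sub_eq_zero.mp h))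
  · rintro (rfl | rfl)
    · rfl
    · rw [inv_inv, add_comm]

/-- Iterating the Dickson polynomial of degree `l` at `u + u⁻¹` raises `u` to powers of `l`. -/
theorem Polynomial.dickson_one_one_iterate_eval_add_inv {R : Type*} [CommRing R] (l m : ℕ)
    (u : Rˣ) :
    (fun x : R => (dickson 1 (1 : R) l).eval x)^[m] ((u : R) + ((u⁻¹ : Rˣ) : R)) =
      ((u ^ l ^ m : Rˣ) : R) + (((u ^ l ^ m)⁻¹ : Rˣ) : R) := by
  induction m with
  | zero => simp
  | succ m ih =>
    rw [iterate_succ_apply', ih]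
    rw [dickson_one_one_eval_add_inv _ _ (Units.mul_inv _), pow_succ, pow_mul, ← inv_pow (u ^ l ^ m),
      Units.val_pow_eq_pow_val (u ^ l ^ m), Units.val_pow_eq_pow_val (u ^ l ^ m)⁻¹]

/-- The point `u + u⁻¹` has period `m` under the Dickson polynomial of degree `l` exactly when
`l ^ m` is `1` or `-1` modulo the order of `u`. -/
theorem Polynomial.isPeriodicPt_dickson_one_one_iff {K : Type*} [Field K] (l m : ℕ) (u : Kˣ) :
    IsPeriodicPt (fun x : K => (dickson 1 (1 : K) l).eval x) m ((u : K) + ((u⁻¹ : Kˣ) : K)) ↔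
      (l : ZMod (orderOf u)) ^ m = 1 ∨ (l : ZMod (orderOf u)) ^ m = -1 := by
  rw [IsPeriodicPt, IsFixedPt, dickson_one_one_iterate_eval_add_inv,
    Units.add_inv_eq_add_inv_iff]
  refine or_congr ?_ ?_
  · have h := pow_eq_pow_iff_modEq (x := u) (n := l ^ m) (m := 1)
    rw [pow_one, ← ZMod.natCast_eq_natCast_iff] at h
    simpa using h
  · rw [eq_inv_iff_mul_eq_one, ← pow_succ, ← orderOf_dvd_iff_pow_eq_one,
      ← ZMod.natCast_eq_zero_iff, eq_neg_iff_add_eq_zero]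
    push_cast
    rfl

/-- With a = α + α⁻¹ as in Statement 0 and orderOf α = ℓ^k·d (ℓ ∤ d),
the point b = f^[k](a) (f(x) = T_ℓ(x)) is periodic with minimal period c(d), the least
π ≥ 1 such that ℓ^π ≡ ±1 (mod d). -/
theorem chebyshev_period
    (ℓ p : ℕ) (hℓ : ℓ.Prime) (hp : p.Prime) (hℓp : ℓ ≠ p)
    (n : ℕ) (hn : 1 ≤ n)
    (F : Type*) [Field F] [Fintype F] (hF : Fintype.card F = p ^ (2 * n))
    (a : F) (ha : a ^ (p ^ n) = a)
    (α : Fˣ) (hα : (α : F) + ((α⁻¹ : Fˣ) : F) = a)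
    (k d : ℕ) (hd : ¬ ℓ ∣ d) (hord : orderOf α = ℓ ^ k * d) :
    (fun x : F => (dickson 1 (1 : F) ℓ).eval x)^[k] a ∈
        periodicPts (fun x : F => (dickson 1 (1 : F) ℓ).eval x) ∧
      IsLeast {π : ℕ | 1 ≤ π ∧ ((ℓ : ZMod d) ^ π = 1 ∨ (ℓ : ZMod d) ^ π = -1)}
        (minimalPeriod (fun x : F => (dickson 1 (1 : F) ℓ).eval x)
          ((fun x : F => (dickson 1 (1 : F) ℓ).eval x)^[k] a)) := by
  have hβ : orderOf (α ^ ℓ ^ k) = d := by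
    rw [orderOf_pow_of_dvd (pow_ne_zero k hℓ.ne_zero) ⟨d, hord⟩, hord,
      Nat.mul_div_cancel_left _ (pow_pos hℓ.pos k)]
  have hdpos : 0 < d := Nat.pos_of_ne_zero fun h => hd (h ▸ dvd_zero ℓ)
  rw [← hα, dickson_one_one_iterate_eval_add_inv]
  have hiff := fun m => isPeriodicPt_dickson_one_one_iff ℓ m (α ^ ℓ ^ k)
  rw [hβ] at hiff
  have hper : ((α ^ ℓ ^ k : Fˣ) : F) + (((α ^ ℓ ^ k)⁻¹ : Fˣ) : F) ∈
      periodicPts (fun x : F => (dickson 1 (1 : F) ℓ).eval x) := by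
    refine ⟨d.totient, Nat.totient_pos.mpr hdpos, (hiff _).mpr (Or.inl ?_)⟩
    have h := Nat.ModEq.pow_totient ((Nat.Prime.coprime_iff_not_dvd hℓ).mpr hd)
    simpa using (ZMod.natCast_eq_natCast_iff _ _ _).mpr h
  refine ⟨hper, ⟨minimalPeriod_pos_of_mem_periodicPts hper,
    (hiff _).mp (isPeriodicPt_minimalPeriod _ _)⟩, ?_⟩
  rintro m ⟨hm, h⟩
  exact ((hiff m).mpr h).minimalPeriod_le hm
end

section
/- Let p be a prime, n ≥ 1, and let F be a finite field with |F| = p^(2n). Then for every a ∈ F with a^(p^n) = a, there exists α ∈ Fˣ such that α + α⁻¹ = a and either α^(p^n − 1) = 1 or α^(p^n + 1) = 1. -/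
open Polynomial in
/-- The elements of an extension of a finite field `F` fixed by the `|F|`-power Frobenius come
from `F`. -/
theorem FiniteField.exists_algebraMap_eq_of_pow_card_eq {F K : Type*} [Field F] [Fintype F]
    [Field K] [Algebra F K] {x : K} (hx : x ^ Fintype.card F = x) :
    ∃ y : F, algebraMap F K y = x := by
  have hsplit : (∏ y : F, (X - C y) : F[X]) = X ^ Fintype.card F - X := by
    have hmonic : (X ^ Fintype.card F - X : F[X]).Monic :=
      monic_X_pow_sub (degree_X.trans_lt (by exact_mod_cast Fintype.one_lt_card))
    have h := prod_multiset_X_sub_C_of_monic_of_roots_card_eq hmonic (by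
      rw [FiniteField.roots_X_pow_card_sub_X,
        FiniteField.X_pow_card_sub_X_natDegree_eq F Fintype.one_lt_card]
      rfl)
    rwa [FiniteField.roots_X_pow_card_sub_X] at h
  have h := congrArg (aeval x) hsplit
  simp only [map_prod, map_sub, map_pow, aeval_X, aeval_C, hx, sub_self,
    Finset.prod_eq_zero_iff] at h
  obtain ⟨y, -, hy⟩ := h
  exact ⟨y, (sub_eq_zero.mp hy).symm⟩

open Polynomial in
theorem IsAlgClosed.exists_sq_sub_mul_add_one_eq_zero {K : Type*} [Field K] [IsAlgClosed K]
    (b : K) : ∃ x : K, x ^ 2 - b * x + 1 = 0 := by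
  have hdeg : (C 1 * X ^ 2 + C (-b) * X + C 1 : K[X]).degree = 2 :=
    degree_quadratic one_ne_zero
  obtain ⟨x, hx⟩ := IsAlgClosed.exists_root _ (by rw [hdeg]; decide)
  refine ⟨x, ?_⟩
  simp only [IsRoot.def, eval_add, eval_mul, eval_C, eval_pow, eval_X] at hx
  linear_combination hx

/-- Let F be a finite field of order p^(2n).  Every element a of the
subfield of order p^n (i.e. a^(p^n) = a) is of the form α + α⁻¹ for some α ∈ Fˣ lying
in the subgroup of order p^n − 1 or in the subgroup of order p^n + 1. -/
theorem exists_unit_trace_eq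
    (p n : ℕ) (hp : p.Prime) (hn : 1 ≤ n)
    (F : Type*) [Field F] [Fintype F] (hF : Fintype.card F = p ^ (2 * n)) :
    ∀ a : F, a ^ (p ^ n) = a →
      ∃ α : Fˣ, (α : F) + ((α⁻¹ : Fˣ) : F) = a ∧
        (α ^ (p ^ n - 1) = 1 ∨ α ^ (p ^ n + 1) = 1) := by
  intro a ha
  have : Fact p.Prime := ⟨hp⟩
  have : CharP F p := charP_of_card_eq_prime_pow hF
  let K := AlgebraicClosure F
  have : CharP K p := charP_of_injective_algebraMap (algebraMap F K).injective p
  obtain ⟨x, hx⟩ := IsAlgClosed.exists_sq_sub_mul_add_one_eq_zero (algebraMap F K a)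
  have hx0 : x ≠ 0 := by rintro rfl; simp at hx
  have hfrob : (x ^ p ^ n) ^ 2 - algebraMap F K a * x ^ p ^ n + 1 = 0 := by
    have h := congrArg (iterateFrobenius K p n) hx
    simp only [map_add, map_sub, map_mul, map_pow, map_one, map_zero, iterateFrobenius_def] at h
    rwa [← map_pow, ha] at h
  have hcases : x ^ p ^ n = x ∨ x ^ p ^ n * x = 1 := by
    have h : (x ^ p ^ n - x) * (x ^ p ^ n * x - 1) = 0 := by
      linear_combination x * hfrob - x ^ p ^ n * hx
    simpa only [mul_eq_zero, sub_eq_zero] using h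
  have hcard : x ^ Fintype.card F = x := by
    rw [hF, two_mul, pow_add, pow_mul]
    rcases hcases with h | h
    · rw [h, h]
    · rw [eq_inv_of_mul_eq_one_left h, inv_pow, eq_inv_of_mul_eq_one_left h, inv_inv]
  obtain ⟨y, rfl⟩ := FiniteField.exists_algebraMap_eq_of_pow_card_eq hcard
  have hinj := (algebraMap F K).injective
  have hy0 : y ≠ 0 := by rintro rfl; simp at hx0
  have hy : y ^ 2 - a * y + 1 = 0 := hinj (by simpa using hx)
  refine ⟨Units.mk0 y hy0, ?_, ?_⟩
  · simp only [Units.val_inv_eq_inv_val, Units.val_mk0]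
    field_simp
    linear_combination hy
  · refine hcases.imp (fun h ↦ ?_) fun h ↦ ?_
    · have h' : y ^ p ^ n = y := hinj (by simpa using h)
      ext
      refine mul_right_cancel₀ hy0 ?_
      simp [pow_sub_one_mul (pow_ne_zero n hp.ne_zero), h']
    · ext
      rw [Units.val_pow_eq_pow_val, Units.val_mk0, pow_succ]
      exact hinj (by simpa using h)
end

section
/- Let ℓ be an odd prime, p a prime with p ≠ ℓ, n ≥ 1, and F a finite field with |F| = p^n. Write p^n − 1 = ℓ^(λ⁻) · ω⁻ and p^n + 1 = ℓ^(λ⁺) · ω⁺ with ℓ ∤ ω⁻ and ℓ ∤ ω⁺. Then the number of elements a ∈ F that are periodic under the map f : F → F, f(x) = T_ℓ(x) (i.e., f^[π](a) = a for some π ≥ 1) equals (ω⁻ + ω⁺)/2. -/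
open Polynomial Function

theorem add_inv_eq_add_inv_iff {K : Type*} [Field K] {x y : K} (hx : x ≠ 0) (hy : y ≠ 0) :
    x + x⁻¹ = y + y⁻¹ ↔ x = y ∨ x = y⁻¹ := by
  refine ⟨fun h => ?_, by rintro (rfl | rfl) <;> simp [add_comm]⟩
  have h2 : (x - y) * (x * y - 1) = 0 := by
    field_simp at h
    linear_combination h
  rcases mul_eq_zero.mp h2 with h3 | h3
  · exact .inl (sub_eq_zero.mp h3)
  · exact .inr (eq_inv_of_mul_eq_one_left (sub_eq_zero.mp h3))

theorem exists_eq_add_inv {K : Type*} [Field K] [IsAlgClosed K] (a : K) :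
    ∃ z : K, z ≠ 0 ∧ a = z + z⁻¹ := by
  have hdeg : (X ^ 2 - C a * X + 1 : K[X]).degree = 2 := by compute_degree!
  obtain ⟨z, hz⟩ := IsAlgClosed.exists_root (X ^ 2 - C a * X + 1 : K[X]) (by rw [hdeg]; decide)
  have hz' : z ^ 2 - a * z + 1 = 0 := by simpa using hz
  have hz0 : z ≠ 0 := by
    rintro rfl
    simp at hz'
  refine ⟨z, hz0, ?_⟩
  field_simp
  linear_combination -hz'

theorem iterate_dickson_eval_add_inv {K : Type*} [Field K] {z : K} (hz : z ≠ 0) (ℓ k : ℕ) :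
    (fun x : K => (dickson 1 (1 : K) ℓ).eval x)^[k] (z + z⁻¹)
      = z ^ ℓ ^ k + (z ^ ℓ ^ k)⁻¹ := by
  induction k with
  | zero => simp
  | succ k ih =>
    rw [iterate_succ_apply', ih, ← inv_pow, dickson_one_one_eval_add_inv _ _
      (by rw [← mul_pow, mul_inv_cancel₀ hz, one_pow]), ← pow_mul, ← pow_mul, ← pow_succ, inv_pow]

theorem add_inv_mem_periodicPts_dickson_iff {K : Type*} [Field K] {z : K} (hz : z ≠ 0) {ℓ : ℕ}
    (hℓ : ℓ.Prime) :
    z + z⁻¹ ∈ periodicPts (fun x : K => (dickson 1 (1 : K) ℓ).eval x)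
      ↔ ℓ.Coprime (orderOf z) := by
  rw [mem_periodicPts]
  constructor
  · rintro ⟨k, hk, h⟩
    rw [IsPeriodicPt, IsFixedPt, iterate_dickson_eval_add_inv hz,
      add_inv_eq_add_inv_iff (pow_ne_zero _ hz) hz] at h
    rw [hℓ.coprime_iff_not_dvd]
    intro hd
    have hdk : ℓ ∣ ℓ ^ k := dvd_pow_self ℓ hk.ne'
    have hpos : 1 ≤ ℓ ^ k := Nat.one_le_pow _ _ hℓ.pos
    have key : ℓ ∣ 1 := by
      rcases h with h | h
      · have h1 : z ^ (ℓ ^ k - 1) = 1 := by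
          apply mul_right_cancel₀ hz
          rw [← pow_succ, Nat.sub_add_cancel hpos, h, one_mul]
        have := hd.trans (orderOf_dvd_of_pow_eq_one h1)
        rwa [Nat.dvd_sub_iff_right hpos hdk] at this
      · have h1 : z ^ (ℓ ^ k + 1) = 1 := by
          rw [pow_succ, h, inv_mul_cancel₀ hz]
        exact (Nat.dvd_add_right hdk).mp (hd.trans (orderOf_dvd_of_pow_eq_one h1))
    exact hℓ.one_lt.ne' (Nat.dvd_one.mp key)
  · intro hc
    have hpos : 0 < orderOf z := by
      rw [Nat.pos_iff_ne_zero]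
      intro h0
      rw [h0, Nat.coprime_zero_right] at hc
      exact hℓ.one_lt.ne' hc
    have h1 : z ^ ℓ ^ (orderOf z).totient = z ^ 1 := by
      rw [← pow_mod_orderOf, Nat.ModEq.pow_totient hc, pow_mod_orderOf]
    refine ⟨(orderOf z).totient, Nat.totient_pos.mpr hpos, ?_⟩
    rw [IsPeriodicPt, IsFixedPt, iterate_dickson_eval_add_inv hz, h1, pow_one]

theorem pow_eq_one_iff_of_eq_prime_pow_mul {G : Type*} [Monoid G] {z : G} {ℓ k m w : ℕ}
    (hℓ : ℓ.Prime) (hm : m = ℓ ^ k * w) (hw : ¬ ℓ ∣ w) :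
    z ^ w = 1 ↔ z ^ m = 1 ∧ ℓ.Coprime (orderOf z) := by
  simp only [← orderOf_dvd_iff_pow_eq_one]
  constructor
  · intro h
    exact ⟨hm ▸ h.mul_left _, hℓ.coprime_iff_not_dvd.mpr fun hd => hw (hd.trans h)⟩
  · rintro ⟨h, hc⟩
    exact (Nat.Coprime.pow_left k hc).symm.dvd_of_dvd_mul_left (hm ▸ h)

theorem algebraMap_mem_periodicPts_dickson_iff {F K : Type*} [Field F] [Field K] [Algebra F K]
    (a : F) (ℓ : ℕ) :
    algebraMap F K a ∈ periodicPts (fun x : K => (dickson 1 (1 : K) ℓ).eval x)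
      ↔ a ∈ periodicPts (fun x : F => (dickson 1 (1 : F) ℓ).eval x) := by
  have hsemi : Semiconj (algebraMap F K) (fun x : F => (dickson 1 (1 : F) ℓ).eval x)
      (fun x : K => (dickson 1 (1 : K) ℓ).eval x) := fun x => by
    simp only [← map_one (algebraMap F K), ← map_dickson, eval_map_apply]
  refine ⟨?_, fun h => hsemi.mapsTo_periodicPts h⟩
  rintro ⟨k, hk, h⟩
  refine ⟨k, hk, (algebraMap F K).injective ?_⟩
  rw [(hsemi.iterate_right k).eq]
  exact h

section FiniteField

variable {F K : Type*} [Field F] [Fintype F] [Field K] [Algebra F K]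

theorem FiniteField.mem_range_algebraMap_iff_pow_card_eq (x : K) :
    x ∈ Set.range (algebraMap F K) ↔ x ^ Fintype.card F = x := by
  have hne : (X ^ Fintype.card F - X : F[X]) ≠ 0 :=
    FiniteField.X_pow_card_sub_X_ne_zero F Fintype.one_lt_card
  have hsplit : (X ^ Fintype.card F - X : F[X]).Splits := by
    rw [splits_iff_card_roots, FiniteField.roots_X_pow_card_sub_X,
      FiniteField.X_pow_card_sub_X_natDegree_eq F Fintype.one_lt_card]
    rfl
  have hroots := hsplit.roots_map (algebraMap F K)
  have hneK : (X ^ Fintype.card F - X : K[X]) ≠ 0 :=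
    FiniteField.X_pow_card_sub_X_ne_zero K Fintype.one_lt_card
  rw [FiniteField.roots_X_pow_card_sub_X] at hroots
  have hx := congrArg (x ∈ ·) hroots
  simp only [Polynomial.map_sub, Polynomial.map_pow, map_X, mem_roots hneK, IsRoot.def, eval_sub,
    eval_pow, eval_X, sub_eq_zero, Multiset.mem_map, Finset.mem_val, Finset.mem_univ, true_and,
    eq_iff_iff] at hx
  exact hx.symm

theorem FiniteField.add_inv_mem_range_algebraMap_iff {z : K} (hz : z ≠ 0) :
    z + z⁻¹ ∈ Set.range (algebraMap F K)
      ↔ z ^ (Fintype.card F - 1) = 1 ∨ z ^ (Fintype.card F + 1) = 1 := by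
  have hadd : (z + z⁻¹) ^ Fintype.card F = z ^ Fintype.card F + (z ^ Fintype.card F)⁻¹ := by
    have := map_add (FiniteField.frobeniusAlgHom F K) z z⁻¹
    simpa [FiniteField.coe_frobeniusAlgHom] using this
  rw [FiniteField.mem_range_algebraMap_iff_pow_card_eq, hadd,
    add_inv_eq_add_inv_iff (pow_ne_zero _ hz) hz]
  refine or_congr ?_ ?_
  · rw [← mul_left_inj' (a := z ^ (Fintype.card F - 1)) hz, ← pow_succ,
      Nat.sub_add_cancel Fintype.card_pos, one_mul]
  · rw [← mul_eq_one_iff_eq_inv₀ hz, ← pow_succ]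

end FiniteField

theorem card_nthRootsFinset_of_ne_zero {K : Type*} [Field K] [IsAlgClosed K] {w : ℕ}
    (hw : (w : K) ≠ 0) : (nthRootsFinset w (1 : K)).card = w := by
  have : NeZero (w : K) := ⟨hw⟩
  obtain ⟨ζ, hζ⟩ := HasEnoughRootsOfUnity.exists_primitiveRoot K w
  exact hζ.card_nthRootsFinset

/-- Let ℓ be an odd prime, p ≠ ℓ prime, F a finite field of order p^n,
and write p^n − 1 = ℓ^(λ⁻)·ω⁻, p^n + 1 = ℓ^(λ⁺)·ω⁺ with ℓ ∤ ω⁻, ℓ ∤ ω⁺.  Then the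
number of periodic points of x ↦ T_ℓ(x) on F equals (ω⁻ + ω⁺)/2. -/
theorem chebyshev_periodic_count_odd
    (ℓ p : ℕ) (hℓ : ℓ.Prime) (hℓodd : Odd ℓ) (hp : p.Prime) (hℓp : p ≠ ℓ)
    (n : ℕ) (hn : 1 ≤ n)
    (F : Type*) [Field F] [Fintype F] (hF : Fintype.card F = p ^ n)
    (lminus lplus wminus wplus : ℕ)
    (hminus : p ^ n - 1 = ℓ ^ lminus * wminus)
    (hplus : p ^ n + 1 = ℓ ^ lplus * wplus)
    (hwminus : ¬ ℓ ∣ wminus) (hwplus : ¬ ℓ ∣ wplus) :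
    2 * {a : F | a ∈ periodicPts (fun x : F => (dickson 1 (1 : F) ℓ).eval x)}.ncard
      = wminus + wplus := by
  classical
  let K := AlgebraicClosure F
  rw [← hF] at hminus hplus
  set q := Fintype.card F with hq
  have hq1 : 1 ≤ q := Fintype.card_pos
  have hqK : (q : K) = 0 := by
    rw [← map_natCast (algebraMap F K), hq, Nat.cast_card_eq_zero, map_zero]
  have hwmK : (wminus : K) ≠ 0 := fun h => by
    have := congrArg (Nat.cast (R := K)) hminus
    rw [Nat.cast_sub hq1, hqK, Nat.cast_mul, h] at this
    simp at this
  have hwpK : (wplus : K) ≠ 0 := fun h => by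
    have := congrArg (Nat.cast (R := K)) hplus
    rw [Nat.cast_add, hqK, Nat.cast_mul, h] at this
    simp at this
  have hwm0 : 0 < wminus := Nat.pos_of_ne_zero fun h => hwmK (by simp [h])
  have hwp0 : 0 < wplus := Nat.pos_of_ne_zero fun h => hwpK (by simp [h])
  set P : Finset K := (Finset.univ.filter fun a : F =>
    a ∈ periodicPts (fun x : F => (dickson 1 (1 : F) ℓ).eval x)).image (algebraMap F K) with hP
  have hPcard : {a : F | a ∈ periodicPts (fun x : F => (dickson 1 (1 : F) ℓ).eval x)}.ncard
      = P.card := by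
    rw [hP, Finset.card_image_of_injective _ (algebraMap F K).injective,
      ← Set.ncard_coe_finset]
    simp
  set A := nthRootsFinset wminus (1 : K) with hA
  set B := nthRootsFinset wplus (1 : K) with hB
  have memA (z : K) : z ∈ A ↔ z ^ (q - 1) = 1 ∧ ℓ.Coprime (orderOf z) := by
    rw [hA, mem_nthRootsFinset hwm0, pow_eq_one_iff_of_eq_prime_pow_mul hℓ hminus hwminus]
  have memB (z : K) : z ∈ B ↔ z ^ (q + 1) = 1 ∧ ℓ.Coprime (orderOf z) := by
    rw [hB, mem_nthRootsFinset hwp0, pow_eq_one_iff_of_eq_prime_pow_mul hℓ hplus hwplus]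
  have memP {z : K} (hz : z ≠ 0) : z + z⁻¹ ∈ P ↔ z ∈ A ∨ z ∈ B := by
    rw [memA, memB, ← or_and_right, ← FiniteField.add_inv_mem_range_algebraMap_iff hz,
      ← add_inv_mem_periodicPts_dickson_iff hz hℓ, hP, Finset.mem_image]
    constructor
    · rintro ⟨a, ha, hza⟩
      refine ⟨⟨a, hza⟩, hza ▸ ?_⟩
      rw [algebraMap_mem_periodicPts_dickson_iff]
      simpa using ha
    · rintro ⟨⟨a, hza⟩, hper⟩
      rw [← hza, algebraMap_mem_periodicPts_dickson_iff] at hper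
      exact ⟨a, by simpa using hper, hza⟩
  have hA0 {z : K} (h : z ∈ A) : z ≠ 0 := ne_zero_of_mem_nthRootsFinset one_ne_zero h
  have hB0 {z : K} (h : z ∈ B) : z ≠ 0 := ne_zero_of_mem_nthRootsFinset one_ne_zero h
  have invA (z : K) : z⁻¹ ∈ A ↔ z ∈ A := by
    simp [hA, mem_nthRootsFinset hwm0, inv_pow]
  have invB (z : K) : z⁻¹ ∈ B ↔ z ∈ B := by
    simp [hB, mem_nthRootsFinset hwp0, inv_pow]
  have hpow (z : K) : z ^ (q + 1) = z ^ (q - 1) * z ^ 2 := by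
    rw [← pow_add]
    congr 1
    omega
  have hfiber : ∀ c ∈ P, (A.filter fun z => z + z⁻¹ = c).card
      + (B.filter fun z => z + z⁻¹ = c).card = 2 := by
    intro c hc
    obtain ⟨z, hz, rfl⟩ := exists_eq_add_inv c
    have fiber (S : Finset K) (hS0 : ∀ y ∈ S, y ≠ 0) (hinv : z⁻¹ ∈ S ↔ z ∈ S) :
        (S.filter fun y => y + y⁻¹ = z + z⁻¹) = if z ∈ S then {z, z⁻¹} else ∅ := by
      ext y
      have key : y ∈ S → (y + y⁻¹ = z + z⁻¹ ↔ y = z ∨ y = z⁻¹) := fun hy =>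
        add_inv_eq_add_inv_iff (hS0 y hy) hz
      split_ifs with h <;> simp only [Finset.mem_filter, Finset.mem_insert, Finset.mem_singleton,
        Finset.notMem_empty] <;> grind
    rw [fiber A (fun _ => hA0) (invA z), fiber B (fun _ => hB0) (invB z)]
    have hsq : z = z⁻¹ ↔ z ^ 2 = 1 := by
      rw [← mul_eq_one_iff_eq_inv₀ hz, sq]
    have hAB : z ∈ A ∧ z ∈ B ↔ z = z⁻¹ := by
      have h := (memP hz).mp hc
      rw [memA, memB, hpow] at h ⊢
      rw [hsq]
      constructor
      · rintro ⟨⟨h1, -⟩, h2, -⟩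
        rwa [h1, one_mul] at h2
      · intro h2
        rw [h2, mul_one] at h ⊢
        tauto
    have h := (memP hz).mp hc
    by_cases h1 : z = z⁻¹
    · obtain ⟨hzA, hzB⟩ := hAB.mpr h1
      simp [hzA, hzB, ← h1]
    · have hcard : ({z, z⁻¹} : Finset K).card = 2 := Finset.card_pair h1
      rcases h with hzA | hzB
      · have hzB : z ∉ B := fun hzB => h1 (hAB.mp ⟨hzA, hzB⟩)
        simp [hzA, hzB, hcard]
      · have hzA : z ∉ A := fun hzA => h1 (hAB.mp ⟨hzA, hzB⟩)
        simp [hzA, hzB, hcard]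
  rw [hPcard, ← card_nthRootsFinset_of_ne_zero hwmK, ← card_nthRootsFinset_of_ne_zero hwpK,
    Finset.card_eq_sum_card_fiberwise (f := fun z : K => z + z⁻¹) (s := nthRootsFinset wminus 1)
      (t := P) fun z hz => (memP (hA0 hz)).mpr (.inl hz),
    Finset.card_eq_sum_card_fiberwise (f := fun z : K => z + z⁻¹) (s := nthRootsFinset wplus 1)
      (t := P) fun z hz => (memP (hB0 hz)).mpr (.inr hz),
    ← Finset.sum_add_distrib, Finset.sum_congr rfl hfiber, Finset.sum_const, smul_eq_mul, mul_comm]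
end

section
/- Let p be an odd prime, n ≥ 1, and F a finite field with |F| = p^n. Write p^n − 1 = 2^(λ⁻) · ω⁻ and p^n + 1 = 2^(λ⁺) · ω⁺ with ω⁻ and ω⁺ odd. Then for the map f : F → F, f(x) = T_2(x) = x² − 2: the number of elements of F that are periodic under f equals (ω⁻ + ω⁺)/2, and the number of elements of F with preperiod exactly 1 under f also equals (ω⁻ + ω⁺)/2. -/
open Polynomial Function

/-- The preperiod of `a` under `f` : the least `ρ ≥ 0` such that `f^[ρ] a` is a
periodic point of `f`. -/
noncomputable def preperiod {S : Type*} (f : S → S) (a : S) : ℕ :=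
  sInf {ρ : ℕ | f^[ρ] a ∈ Function.periodicPts f}

theorem FiniteField.mem_range_algebraMap_of_pow_card_eq_self {F K : Type*} [Field F] [Fintype F]
    [Field K] [Algebra F K] {w : K} (hw : w ^ Fintype.card F = w) :
    w ∈ Set.range (algebraMap F K) := by
  have h : (X ^ Fintype.card F - X : F[X]).Splits := by
    rw [splits_iff_card_roots, FiniteField.roots_X_pow_card_sub_X,
      FiniteField.X_pow_card_sub_X_natDegree_eq _ Fintype.one_lt_card]
    rfl
  have h0 := FiniteField.X_pow_card_sub_X_ne_zero K (Fintype.one_lt_card (α := F))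
  have hroot : w ∈ (X ^ Fintype.card F - X : K[X]).roots := by
    simp [h0, hw]
  have hmap := h.roots_map (algebraMap F K)
  rw [FiniteField.roots_X_pow_card_sub_X] at hmap
  simp only [Polynomial.map_sub, Polynomial.map_pow, map_X] at hmap
  rw [hmap] at hroot
  simpa using hroot

section Joukowski

variable {K : Type*} [Field K]

theorem iterate_sq_sub_two_add_inv {z : K} (hz : z ≠ 0) (k : ℕ) :
    (fun x : K ↦ x ^ 2 - 2)^[k] (z + z⁻¹) = z ^ 2 ^ k + (z ^ 2 ^ k)⁻¹ := by
  induction k with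
  | zero => simp
  | succ k ih =>
    rw [iterate_succ_apply', ih, pow_succ 2 k, pow_mul]
    have := pow_ne_zero (2 ^ k) hz
    field_simp
    ring

theorem add_inv_eq_add_inv_iff_s6 {z w : K} (hz : z ≠ 0) (hw : w ≠ 0) :
    z + z⁻¹ = w + w⁻¹ ↔ z = w ∨ z = w⁻¹ := by
  constructor
  · intro h
    have : (z - w) * (z * w - 1) = 0 := by
      field_simp at h
      linear_combination h
    rcases mul_eq_zero.1 this with h | h
    · exact Or.inl (sub_eq_zero.1 h)
    · exact Or.inr (eq_inv_of_mul_eq_one_left (sub_eq_zero.1 h))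
  · rintro (rfl | rfl)
    · rfl
    · rw [inv_inv, add_comm]

/-- Points `z + z⁻¹` periodic under `x ↦ x ^ 2 - 2` come from the `z` of odd order. -/
theorem add_inv_mem_periodicPts_iff {z : K} (hz : z ≠ 0) :
    z + z⁻¹ ∈ periodicPts (fun x : K ↦ x ^ 2 - 2) ↔ Odd (orderOf z) := by
  rw [mem_periodicPts]
  constructor
  · rintro ⟨k, hk, h⟩
    rw [IsPeriodicPt, IsFixedPt, iterate_sq_sub_two_add_inv hz,
      add_inv_eq_add_inv_iff_s6 (pow_ne_zero _ hz) hz] at h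
    have h2 : 2 ∣ 2 ^ k := dvd_pow_self 2 hk.ne'
    have hpos : 0 < 2 ^ k := by positivity
    rcases h with h | h
    · have : z ^ (2 ^ k - 1) = 1 := by
        rw [pow_sub₀ _ hz hpos, h, pow_one, mul_inv_cancel₀ hz]
      exact Odd.of_dvd_nat (by rw [Nat.odd_iff]; omega) (orderOf_dvd_of_pow_eq_one this)
    · have : z ^ (2 ^ k + 1) = 1 := by
        rw [pow_succ, h, inv_mul_cancel₀ hz]
      exact Odd.of_dvd_nat (by rw [Nat.odd_iff]; omega) (orderOf_dvd_of_pow_eq_one this)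
  · intro h
    refine ⟨(orderOf z).totient, Nat.totient_pos.2 h.pos, ?_⟩
    have hmod : 2 ^ (orderOf z).totient % orderOf z = 1 % orderOf z :=
      Nat.ModEq.pow_totient (Nat.coprime_two_left.2 h)
    rw [IsPeriodicPt, IsFixedPt, iterate_sq_sub_two_add_inv hz, ← pow_mod_orderOf, hmod,
      pow_mod_orderOf, pow_one]

theorem exists_add_inv_eq [IsAlgClosed K] (a : K) : ∃ z : K, z ≠ 0 ∧ z + z⁻¹ = a := by
  obtain ⟨z, hz⟩ := IsAlgClosed.exists_root (C 1 * X ^ 2 + C (-a) * X + C 1 : K[X])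
    (by rw [degree_quadratic one_ne_zero]; decide)
  have hz' : z ^ 2 - a * z + 1 = 0 := by
    simpa [IsRoot, sub_eq_add_neg] using hz
  have h0 : z ≠ 0 := by
    rintro rfl
    simp at hz'
  refine ⟨z, h0, ?_⟩
  field_simp
  linear_combination hz'

open Finset in
/-- A fibre of `x ↦ x + x⁻¹` meets the roots of unity of order `m` and those of order `n`, for
coprime odd `m` and `n`, twice in total as soon as it meets them. -/
theorem card_filter_add_inv_add_card_filter_add_inv [DecidableEq K] {m n : ℕ} (hm : Odd m)
    (hn : Odd n) (hmn : m.Coprime n) {z : K} (hz : z ^ m = 1) :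
    #{x ∈ nthRootsFinset m (1 : K) | x + x⁻¹ = z + z⁻¹} +
      #{x ∈ nthRootsFinset n (1 : K) | x + x⁻¹ = z + z⁻¹} = 2 := by
  have ne_zero {k : ℕ} (hk : Odd k) {x : K} (hx : x ^ k = 1) : x ≠ 0 := by
    rintro rfl
    simp [hk.pos.ne'] at hx
  have hz0 := ne_zero hm hz
  by_cases h1 : z = 1
  · subst h1
    have key {k : ℕ} (hk : Odd k) :
        {x ∈ nthRootsFinset k (1 : K) | x + x⁻¹ = 1 + 1⁻¹} = {1} := by
      ext x
      rw [mem_filter, mem_nthRootsFinset hk.pos, mem_singleton]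
      constructor
      · rintro ⟨hx, h⟩
        simpa using (add_inv_eq_add_inv_iff_s6 (ne_zero hk hx) one_ne_zero).1 h
      · rintro rfl
        simp
    rw [key hm, key hn, card_singleton]
  · have hfst : {x ∈ nthRootsFinset m (1 : K) | x + x⁻¹ = z + z⁻¹} = {z, z⁻¹} := by
      ext x
      rw [mem_filter, mem_nthRootsFinset hm.pos, mem_insert, mem_singleton]
      constructor
      · rintro ⟨hx, h⟩
        exact (add_inv_eq_add_inv_iff_s6 (ne_zero hm hx) hz0).1 h
      · rintro (rfl | rfl)
        · exact ⟨hz, rfl⟩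
        · exact ⟨by rw [inv_pow, hz, inv_one], by rw [inv_inv, add_comm]⟩
    have hsnd : {x ∈ nthRootsFinset n (1 : K) | x + x⁻¹ = z + z⁻¹} = ∅ := by
      refine filter_eq_empty_iff.2 fun x hx h ↦ h1 ?_
      rw [mem_nthRootsFinset hn.pos] at hx
      have hzn : z ^ n = 1 := by
        rcases (add_inv_eq_add_inv_iff_s6 (ne_zero hn hx) hz0).1 h with rfl | rfl
        · exact hx
        · simpa using hx
      exact orderOf_eq_one_iff.1 <| Nat.eq_one_of_dvd_coprimes hmn
        (orderOf_dvd_of_pow_eq_one hz) (orderOf_dvd_of_pow_eq_one hzn)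
    have hne : z ≠ z⁻¹ := by
      intro h
      refine h1 <| orderOf_eq_one_iff.1 <| Nat.eq_one_of_dvd_coprimes (Nat.coprime_two_right.2 hm)
        (orderOf_dvd_of_pow_eq_one hz) (orderOf_dvd_of_pow_eq_one ?_)
      rw [sq]
      nth_rewrite 2 [h]
      exact mul_inv_cancel₀ hz0
    rw [hfst, hsnd, card_pair hne, card_empty]

theorem card_nthRootsFinset_one_of_ne_zero [IsAlgClosed K] {m : ℕ} (hm : (m : K) ≠ 0) :
    (nthRootsFinset m (1 : K)).card = m := by
  have : NeZero (m : K) := ⟨hm⟩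
  exact (HasEnoughRootsOfUnity.exists_primitiveRoot K m).choose_spec.card_nthRootsFinset

end Joukowski

theorem preperiod_eq_one_iff {S : Type*} (f : S → S) (a : S) :
    preperiod f a = 1 ↔ f a ∈ periodicPts f ∧ a ∉ periodicPts f := by
  rw [preperiod]
  constructor
  · intro h
    have hne : {ρ : ℕ | f^[ρ] a ∈ periodicPts f}.Nonempty := by
      by_contra hne
      simp [Set.not_nonempty_iff_eq_empty.1 hne] at h
    refine ⟨by simpa [h] using Nat.sInf_mem hne, fun ha ↦ ?_⟩
    have := Nat.sInf_le (s := {ρ : ℕ | f^[ρ] a ∈ periodicPts f}) (m := 0) ha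
    omega
  · rintro ⟨h, ha⟩
    refine le_antisymm (Nat.sInf_le h) (Nat.one_le_iff_ne_zero.2 fun h0 ↦ ?_)
    rcases Nat.sInf_eq_zero.1 h0 with h0 | h0
    · exact ha h0
    · exact Set.eq_empty_iff_forall_notMem.1 h0 1 h

section FiniteField

variable {F : Type*} [Field F]

theorem preperiod_sq_sub_two_eq_one_iff (h2 : (2 : F) ≠ 0) (a : F) :
    preperiod (fun x : F ↦ x ^ 2 - 2) a = 1 ↔ -a ∈ periodicPts (fun x : F ↦ x ^ 2 - 2) := by
  set f : F → F := fun x ↦ x ^ 2 - 2 with hf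
  have hbij := bijOn_periodicPts f
  have hfneg (x : F) : f (-x) = f x := by simp [hf]
  have hzero : (0 : F) ∉ periodicPts f := by
    intro h
    have hfix : f (f (f 0)) = f (f 0) := by
      simp only [hf]
      ring
    have h0 := hbij.injOn (hbij.mapsTo (hbij.mapsTo h)) (hbij.mapsTo h) hfix
    have h0' := hbij.injOn (hbij.mapsTo h) h h0
    simp [hf, h2] at h0'
  rw [preperiod_eq_one_iff]
  constructor
  · rintro ⟨h, ha⟩
    obtain ⟨b, hb, hba⟩ := hbij.surjOn h
    have : b ^ 2 = a ^ 2 := by simpa [hf] using hba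
    rcases sq_eq_sq_iff_eq_or_eq_neg.1 this with rfl | rfl
    · exact absurd hb ha
    · exact hb
  · intro h
    refine ⟨hfneg a ▸ hbij.mapsTo h, fun ha ↦ hzero ?_⟩
    have hneg := hbij.injOn h ha (hfneg a)
    have : 2 * a = 0 := by linear_combination -hneg
    rwa [(mul_eq_zero.1 this).resolve_left h2] at ha

variable [Fintype F]

theorem pow_card_eq_self_or_inv_of_add_inv_eq_algebraMap {K : Type*} [Field K] [Algebra F K]
    {z : K} (hz : z ≠ 0) {a : F} (h : z + z⁻¹ = algebraMap F K a) :
    z ^ Fintype.card F = z ∨ z ^ Fintype.card F = z⁻¹ := by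
  have hfrob := congr_arg (FiniteField.frobeniusAlgHom F K) h
  rw [map_add, map_inv₀, AlgHom.commutes, ← h] at hfrob
  exact (add_inv_eq_add_inv_iff_s6 (pow_ne_zero _ hz) hz).1 hfrob

theorem add_inv_mem_range_algebraMap {K : Type*} [Field K] [Algebra F K] {z : K}
    (h : z ^ Fintype.card F = z ∨ z ^ Fintype.card F = z⁻¹) :
    z + z⁻¹ ∈ Set.range (algebraMap F K) := by
  refine FiniteField.mem_range_algebraMap_of_pow_card_eq_self ?_
  change FiniteField.frobeniusAlgHom F K (z + z⁻¹) = _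
  rw [map_add, map_inv₀, FiniteField.coe_frobeniusAlgHom]
  rcases h with h | h
  · simp only [h]
  · simp only [h, inv_inv, add_comm]

theorem map_mem_periodicPts_iff_of_injective {α β : Type*} {f : α → α} {g : β → β} {φ : α → β}
    (hφ : Injective φ) (h : Semiconj φ f g) {a : α} :
    φ a ∈ periodicPts g ↔ a ∈ periodicPts f := by
  refine ⟨?_, fun ha ↦ h.mapsTo_periodicPts ha⟩
  rintro ⟨k, hk, hp⟩
  exact ⟨k, hk, hφ ((h.iterate_right k a).trans hp)⟩

theorem add_inv_mem_image_periodicPts_iff {K : Type*} [Field K] [Algebra F K]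
    {l k m n : ℕ} (hminus : Fintype.card F - 1 = 2 ^ l * m) (hplus : Fintype.card F + 1 = 2 ^ k * n)
    (hm : Odd m) (hn : Odd n) {z : K} (hz : z ≠ 0) :
    z + z⁻¹ ∈ algebraMap F K '' periodicPts (fun x : F ↦ x ^ 2 - 2) ↔ z ^ m = 1 ∨ z ^ n = 1 := by
  have hq : Fintype.card F - 1 + 1 = Fintype.card F := Nat.sub_add_cancel Fintype.card_pos
  have hper {a : F} (ha : algebraMap F K a = z + z⁻¹) :
      a ∈ periodicPts (fun x : F ↦ x ^ 2 - 2) ↔ Odd (orderOf z) := by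
    rw [← add_inv_mem_periodicPts_iff hz, ← ha]
    refine (map_mem_periodicPts_iff_of_injective (algebraMap F K).injective fun x ↦ ?_).symm
    rw [map_sub, map_pow, map_ofNat]
  constructor
  · rintro ⟨a, ha, haz⟩
    have hcop (j : ℕ) : (orderOf z).Coprime (2 ^ j) :=
      (Nat.coprime_two_right.2 ((hper haz).1 ha)).pow_right j
    rcases pow_card_eq_self_or_inv_of_add_inv_eq_algebraMap hz haz.symm with h | h
    · have h1 : z ^ (2 ^ l * m) = 1 := by
        rw [← hq, pow_succ] at h
        rw [← hminus]
        exact mul_right_cancel₀ hz (h.trans (one_mul z).symm)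
      exact Or.inl (orderOf_dvd_iff_pow_eq_one.1
        ((hcop l).dvd_of_dvd_mul_left (orderOf_dvd_of_pow_eq_one h1)))
    · have h1 : z ^ (2 ^ k * n) = 1 := by
        rw [← hplus, pow_succ, h, inv_mul_cancel₀ hz]
      exact Or.inr (orderOf_dvd_iff_pow_eq_one.1
        ((hcop k).dvd_of_dvd_mul_left (orderOf_dvd_of_pow_eq_one h1)))
  · intro h
    have hodd : Odd (orderOf z) := by
      rcases h with h | h
      · exact hm.of_dvd_nat (orderOf_dvd_of_pow_eq_one h)
      · exact hn.of_dvd_nat (orderOf_dvd_of_pow_eq_one h)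
    have hfrob : z ^ Fintype.card F = z ∨ z ^ Fintype.card F = z⁻¹ := by
      refine h.imp (fun h ↦ ?_) fun h ↦ eq_inv_of_mul_eq_one_left ?_
      · rw [← hq, pow_succ, hminus, pow_mul', h, one_pow, one_mul]
      · rw [← pow_succ, hplus, pow_mul', h, one_pow]
    obtain ⟨a, ha⟩ := add_inv_mem_range_algebraMap hfrob
    exact ⟨a, (hper ha).2 hodd, ha⟩

open Finset in
theorem two_mul_ncard_periodicPts_sq_sub_two {l k m n : ℕ}
    (hminus : Fintype.card F - 1 = 2 ^ l * m) (hplus : Fintype.card F + 1 = 2 ^ k * n)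
    (hm : Odd m) (hn : Odd n) :
    2 * (periodicPts (fun x : F ↦ x ^ 2 - 2)).ncard = m + n := by
  classical
  obtain ⟨K, _, _, _⟩ : ∃ (K : Type _) (_ : Field K) (_ : Algebra F K), IsAlgClosed K :=
    ⟨AlgebraicClosure F, inferInstance, inferInstance, inferInstance⟩
  have hq : Fintype.card F - 1 + 1 = Fintype.card F := Nat.sub_add_cancel Fintype.card_pos
  have hcard : (Fintype.card F : K) = 0 := by
    rw [← map_natCast (algebraMap F K), Nat.cast_card_eq_zero, map_zero]
  have hmK : (m : K) ≠ 0 := by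
    intro h
    rw [← hq, hminus] at hcard
    simp [h] at hcard
  have hnK : (n : K) ≠ 0 := by
    intro h
    have := congr_arg (Nat.cast : ℕ → K) hplus
    simp [h, hcard] at this
  have hmn : m.Coprime n := by
    have h2 : m.gcd n ∣ 2 := by
      have h1 : m.gcd n ∣ Fintype.card F - 1 :=
        (Nat.gcd_dvd_left m n).trans (hminus ▸ dvd_mul_left m _)
      have h3 : m.gcd n ∣ Fintype.card F - 1 + 2 := by
        rw [show Fintype.card F - 1 + 2 = Fintype.card F + 1 by omega, hplus]
        exact (Nat.gcd_dvd_right m n).trans (dvd_mul_left n _)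
      exact (Nat.dvd_add_right h1).1 h3
    exact Nat.eq_one_of_dvd_coprimes (Nat.coprime_two_right.2 hm) (Nat.gcd_dvd_left m n) h2
  set S : Finset K := (algebraMap F K '' periodicPts (fun x : F ↦ x ^ 2 - 2)).toFinite.toFinset
    with hS
  have hSmem {z : K} (hz : z ≠ 0) : z + z⁻¹ ∈ S ↔ z ^ m = 1 ∨ z ^ n = 1 := by
    rw [hS, Set.Finite.mem_toFinset, add_inv_mem_image_periodicPts_iff hminus hplus hm hn hz]
  have hSncard : #S = (periodicPts (fun x : F ↦ x ^ 2 - 2)).ncard := by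
    rw [hS, ← Set.ncard_eq_toFinset_card _ _, Set.ncard_image_of_injective _ (algebraMap F K).injective]
  have hmaps {j : ℕ} (hj : Odd j) (hjmn : j = m ∨ j = n) :
      ∀ x ∈ nthRootsFinset j (1 : K), x + x⁻¹ ∈ S := by
    intro x hx
    rw [mem_nthRootsFinset hj.pos] at hx
    have hx0 : x ≠ 0 := by
      rintro rfl
      simp [hj.pos.ne'] at hx
    rw [hSmem hx0]
    rcases hjmn with rfl | rfl
    · exact Or.inl hx
    · exact Or.inr hx
  have hfibre (w : K) (hw : w ∈ S) : #{x ∈ nthRootsFinset m (1 : K) | x + x⁻¹ = w} +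
      #{x ∈ nthRootsFinset n (1 : K) | x + x⁻¹ = w} = 2 := by
    obtain ⟨z, hz, rfl⟩ := exists_add_inv_eq w
    rcases (hSmem hz).1 hw with h | h
    · exact card_filter_add_inv_add_card_filter_add_inv hm hn hmn h
    · rw [add_comm]
      exact card_filter_add_inv_add_card_filter_add_inv hn hm hmn.symm h
  calc 2 * (periodicPts (fun x : F ↦ x ^ 2 - 2)).ncard = ∑ w ∈ S, 2 := by
        rw [sum_const, smul_eq_mul, hSncard, mul_comm]
    _ = #(nthRootsFinset m (1 : K)) + #(nthRootsFinset n (1 : K)) := by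
        rw [card_eq_sum_card_fiberwise (hmaps hm (Or.inl rfl)),
          card_eq_sum_card_fiberwise (hmaps hn (Or.inr rfl)), ← sum_add_distrib]
        exact (sum_congr rfl hfibre).symm
    _ = m + n := by
        rw [card_nthRootsFinset_one_of_ne_zero hmK, card_nthRootsFinset_one_of_ne_zero hnK]

end FiniteField

/-- Let p be an odd prime, F a finite field of order p^n, and write
p^n − 1 = 2^(λ⁻)·ω⁻, p^n + 1 = 2^(λ⁺)·ω⁺ with ω⁻, ω⁺ odd.  For f(x) = T₂(x) = x² − 2,
the number of periodic points equals (ω⁻ + ω⁺)/2, and so does the number of points of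
preperiod exactly 1. -/
theorem chebyshev_two_count
    (p : ℕ) (hp : p.Prime) (hpodd : Odd p)
    (n : ℕ) (hn : 1 ≤ n)
    (F : Type*) [Field F] [Fintype F] (hF : Fintype.card F = p ^ n)
    (lminus lplus wminus wplus : ℕ)
    (hminus : p ^ n - 1 = 2 ^ lminus * wminus)
    (hplus : p ^ n + 1 = 2 ^ lplus * wplus)
    (hwminus : Odd wminus) (hwplus : Odd wplus) :
    2 * {a : F | a ∈ periodicPts (fun x : F => (dickson 1 (1 : F) 2).eval x)}.ncard
        = wminus + wplus ∧
    2 * {a : F |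
          preperiod (fun x : F => (dickson 1 (1 : F) 2).eval x) a = 1}.ncard
        = wminus + wplus := by
  have hf : (fun x : F ↦ (dickson 1 (1 : F) 2).eval x) = fun x ↦ x ^ 2 - 2 := by
    funext x
    simp only [dickson_two, eval_sub, eval_pow, eval_X, eval_mul, eval_C, one_mul]
    norm_num
  rw [hf]
  rw [← hF] at hminus hplus
  have h2 : (2 : F) ≠ 0 := by
    obtain ⟨r, hr⟩ := hF ▸ hpodd.pow (n := n)
    have hcard := Nat.cast_card_eq_zero F
    intro h
    simp [hr, h] at hcard
  have hcount := two_mul_ncard_periodicPts_sq_sub_two hminus hplus hwminus hwplus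
  refine ⟨hcount, ?_⟩
  simp_rw [preperiod_sq_sub_two_eq_one_iff h2]
  rw [← hcount]
  congr 1
  rw [← Set.ncard_image_of_injective _ (neg_injective (G := F)), Set.image_neg_eq_neg]
  congr 1
  ext a
  simp
end

section
/- Let ℓ and p be distinct primes, n ≥ 1, and let E be a finite field with |E| = p^(2n). Let d > 2 be an integer with ℓ ∤ d such that d divides p^n − 1 or d divides p^n + 1. Let A_d be the set of a ∈ E with a^(p^n) = a for which there exists α ∈ Eˣ with α + α⁻¹ = a and multiplicative order of α equal to d. Then A_d has exactly φ(d)/2 elements, and every a ∈ A_d is periodic under the map f(x) = T_ℓ(x) with minimal period exactly c(d), the least π ≥ 1 with ℓ^π ≡ ±1 (mod d). -/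
open Polynomial Function

/-- Two units have the same sum with their inverse iff they are equal or mutually inverse. -/
theorem Units.add_inv_eq_add_inv_iff_s8 {E : Type*} [Field E] (α β : Eˣ) :
    (α : E) + ((α⁻¹ : Eˣ) : E) = β + ((β⁻¹ : Eˣ) : E) ↔ α = β ∨ α = β⁻¹ := by
  constructor
  · intro h
    have hα : (α : E) * ((α⁻¹ : Eˣ) : E) = 1 := α.mul_inv
    have hβ : (β : E) * ((β⁻¹ : Eˣ) : E) = 1 := β.mul_inv
    have h0 : ((α : E) - β) * ((α : E) - ((β⁻¹ : Eˣ) : E)) = 0 := by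
      linear_combination (α : E) * h - hα + hβ
    rcases mul_eq_zero.mp h0 with h1 | h1
    · exact Or.inl (Units.ext (sub_eq_zero.mp h1))
    · exact Or.inr (Units.ext (sub_eq_zero.mp h1))
  · rintro (rfl | rfl)
    · rfl
    · rw [inv_inv, add_comm]

/-- Iterating the Dickson polynomial at `α + α⁻¹` raises `α` to iterated powers. -/
theorem iterate_eval_dickson_add_inv {E : Type*} [Field E] (ℓ : ℕ) (α : Eˣ) (k : ℕ) :
    (fun x : E => (dickson 1 (1 : E) ℓ).eval x)^[k] ((α : E) + ((α⁻¹ : Eˣ) : E)) =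
      ((α ^ ℓ ^ k : Eˣ) : E) + (((α ^ ℓ ^ k)⁻¹ : Eˣ) : E) := by
  induction k with
  | zero => simp
  | succ k ih =>
    rw [iterate_succ_apply', ih]
    rw [dickson_one_one_eval_add_inv _ _ (Units.mul_inv _), pow_succ ℓ k, pow_mul, ← inv_pow _ ℓ,
      Units.val_pow_eq_pow_val _ ℓ, Units.val_pow_eq_pow_val _ ℓ]

/-- The point `α + α⁻¹` has period `k` under `T_ℓ` iff `ℓ ^ k ≡ ±1` modulo the order of `α`. -/
theorem isPeriodicPt_eval_dickson_add_inv_iff {E : Type*} [Field E] (ℓ : ℕ) (α : Eˣ) (k : ℕ) :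
    IsPeriodicPt (fun x : E => (dickson 1 (1 : E) ℓ).eval x) k
        ((α : E) + ((α⁻¹ : Eˣ) : E)) ↔
      (ℓ : ZMod (orderOf α)) ^ k = 1 ∨ (ℓ : ZMod (orderOf α)) ^ k = -1 := by
  rw [IsPeriodicPt, IsFixedPt, iterate_eval_dickson_add_inv, Units.add_inv_eq_add_inv_iff_s8]
  refine or_congr ?_ ?_
  · nth_rewrite 2 [← pow_one α]
    rw [pow_eq_pow_iff_modEq, ← ZMod.natCast_eq_natCast_iff]
    simp
  · rw [eq_inv_iff_mul_eq_one, ← pow_succ, ← orderOf_dvd_iff_pow_eq_one,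
      ← ZMod.natCast_eq_zero_iff, eq_neg_iff_add_eq_zero]
    simp

/-- The elements of order `d` in a finite field of which `d > 2` divides the number of units
give exactly `φ(d) / 2` sums `α + α⁻¹`. -/
theorem two_mul_ncard_image_add_inv {E : Type*} [Field E] [Fintype E] {d : ℕ} (hd2 : 2 < d)
    (hd : d ∣ Fintype.card E - 1) :
    2 * ((fun α : Eˣ => (α : E) + ((α⁻¹ : Eˣ) : E)) '' {α | orderOf α = d}).ncard =
      Nat.totient d := by
  classical
  have hcard : (Finset.univ.filter fun α : Eˣ => orderOf α = d).card = Nat.totient d :=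
    IsCyclic.card_orderOf_eq_totient (by rwa [Fintype.card_units])
  set S := Finset.univ.filter fun α : Eˣ => orderOf α = d with hS
  set g : Eˣ → E := fun α => (α : E) + ((α⁻¹ : Eˣ) : E) with hg
  have himage : g '' {α | orderOf α = d} = (S.image g : Finset E) := by
    simp [hS]
  have hfiber : ∀ a ∈ S.image g, (S.filter fun α => g α = a).card = 2 := by
    intro a ha
    obtain ⟨β, hβ, rfl⟩ := Finset.mem_image.mp ha
    have hβd : orderOf β = d := by simpa [hS] using hβ
    have hne : β ≠ β⁻¹ := by
      intro h
      have h2 : β ^ 2 = 1 := by rw [sq]; exact eq_inv_iff_mul_eq_one.mp h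
      have := Nat.le_of_dvd two_pos (orderOf_dvd_of_pow_eq_one h2)
      omega
    rw [show (S.filter fun α => g α = g β) = {β, β⁻¹} from ?_, Finset.card_pair hne]
    ext α
    simp only [hS, hg, Finset.mem_filter, Finset.mem_univ, true_and, Finset.mem_insert,
      Finset.mem_singleton, Units.add_inv_eq_add_inv_iff_s8]
    refine ⟨And.right, fun h => ⟨?_, h⟩⟩
    rcases h with rfl | rfl
    · exact hβd
    · rwa [orderOf_inv]
  rw [himage, Set.ncard_coe_finset, ← hcard, Finset.card_eq_sum_card_image g S,
    Finset.sum_congr rfl hfiber, Finset.sum_const, smul_eq_mul, mul_comm]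

/-- If the order of `α` divides `q - 1` or `q + 1`, where `q` is a power of the characteristic,
then `α + α⁻¹` is fixed by the `q`-power map. -/
theorem add_inv_pow_eq_self {E : Type*} [Field E] {p : ℕ} [Fact p.Prime] [CharP E p] (n : ℕ)
    (α : Eˣ) (h : orderOf α ∣ p ^ n - 1 ∨ orderOf α ∣ p ^ n + 1) :
    ((α : E) + ((α⁻¹ : Eˣ) : E)) ^ p ^ n = (α : E) + ((α⁻¹ : Eˣ) : E) := by
  rw [add_pow_char_pow, ← Units.val_pow_eq_pow_val, ← Units.val_pow_eq_pow_val, inv_pow,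
    Units.add_inv_eq_add_inv_iff_s8]
  refine h.imp (fun h => ?_) fun h => ?_
  · have hpos : 0 < p ^ n := pow_pos (Fact.out : p.Prime).pos n
    rw [← Nat.sub_add_cancel hpos, pow_succ, orderOf_dvd_iff_pow_eq_one.mp h, one_mul]
  · rw [eq_inv_iff_mul_eq_one, ← pow_succ, orderOf_dvd_iff_pow_eq_one.mp h]

/-- Let ℓ ≠ p be primes, E a finite field of order p^(2n) and d > 2
with ℓ ∤ d dividing p^n − 1 or p^n + 1.  The set A_d of a ∈ E with a^(p^n) = a which
are of the form α + α⁻¹ for some α ∈ Eˣ of order exactly d has φ(d)/2 elements, and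
each a ∈ A_d is periodic under x ↦ T_ℓ(x) with minimal period c(d), the least π ≥ 1
with ℓ^π ≡ ±1 (mod d). -/
theorem chebyshev_cycle_structure
    (ℓ p : ℕ) (hℓ : ℓ.Prime) (hp : p.Prime) (hℓp : ℓ ≠ p)
    (n : ℕ) (hn : 1 ≤ n)
    (E : Type*) [Field E] [Fintype E] (hE : Fintype.card E = p ^ (2 * n))
    (d : ℕ) (hd2 : 2 < d) (hℓd : ¬ ℓ ∣ d)
    (hdvd : d ∣ p ^ n - 1 ∨ d ∣ p ^ n + 1) :
    let A : Set E := {a | a ^ (p ^ n) = a ∧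
      ∃ α : Eˣ, (α : E) + ((α⁻¹ : Eˣ) : E) = a ∧ orderOf α = d}
    2 * A.ncard = Nat.totient d ∧
    ∀ a ∈ A,
      a ∈ periodicPts (fun x : E => (dickson 1 (1 : E) ℓ).eval x) ∧
      IsLeast {π : ℕ | 1 ≤ π ∧ ((ℓ : ZMod d) ^ π = 1 ∨ (ℓ : ZMod d) ^ π = -1)}
        (minimalPeriod (fun x : E => (dickson 1 (1 : E) ℓ).eval x) a) := by
  intro A
  have : Fact p.Prime := ⟨hp⟩
  have : CharP E p := charP_of_card_eq_prime_pow hE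
  have hA : A = (fun α : Eˣ => (α : E) + ((α⁻¹ : Eˣ) : E)) '' {α | orderOf α = d} := by
    ext a
    constructor
    · rintro ⟨-, α, hα, hαd⟩
      exact ⟨α, hαd, hα⟩
    · rintro ⟨α, hαd, rfl⟩
      have hαd : orderOf α = d := hαd
      exact ⟨add_inv_pow_eq_self n α (by rwa [hαd]), α, rfl, hαd⟩
  refine ⟨?_, ?_⟩
  · rw [hA]
    refine two_mul_ncard_image_add_inv hd2 ?_
    rw [hE, mul_comm, pow_mul, ← one_pow 2, Nat.sq_sub_sq]
    exact hdvd.elim (fun h => h.mul_left _) fun h => h.mul_right _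
  · rintro a ⟨-, α, rfl, rfl⟩
    have hper : (α : E) + ((α⁻¹ : Eˣ) : E) ∈
        periodicPts (fun x : E => (dickson 1 (1 : E) ℓ).eval x) := by
      refine ⟨Nat.totient (orderOf α), Nat.totient_pos.mpr (by omega), ?_⟩
      rw [isPeriodicPt_eval_dickson_add_inv_iff]
      left
      have h := (ZMod.natCast_eq_natCast_iff _ _ _).mpr
        (Nat.ModEq.pow_totient ((Nat.Prime.coprime_iff_not_dvd hℓ).mpr hℓd))
      simpa using h
    refine ⟨hper, ⟨minimalPeriod_pos_of_mem_periodicPts hper, ?_⟩, ?_⟩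
    · exact (isPeriodicPt_eval_dickson_add_inv_iff ℓ α _).mp (isPeriodicPt_minimalPeriod _ _)
    · rintro k ⟨hk, h⟩
      exact ((isPeriodicPt_eval_dickson_add_inv_iff ℓ α k).mpr h).minimalPeriod_le hk
end

section
/- Let p be an odd prime and t ∈ ℤ with reduction t̄ ∈ F_p, t̄ ≠ −2. Set v = max(ν₂(p − 1), ν₂(p + 1)) and let D₁ ∈ {p − 1, p + 1} be the one with ν₂(D₁) = v. Suppose the preperiod ρ of t̄ under f : F_p → F_p, f(x) = T_2(x) = x² − 2, satisfies ρ > 0, and suppose that in a field E with |E| = p² there exists α ∈ Eˣ with α + α⁻¹ = t̄ whose multiplicative order is 2^ρ · d with d odd and d dividing D₁. Then for every n ≥ 1: (i) if n ≤ v − ρ, the polynomial T_{2^n}(X) − t̄ ∈ F_p[X] splits into a product of 2^n monic linear factors over F_p; (ii) if n > v − ρ, every monic irreducible factor of T_{2^n}(X) − t̄ in F_p[X] has degree 2^(n − v + ρ). In particular, if ρ = v then T_{2^n}(X) − t̄ is irreducible in F_p[X] for every n ≥ 1. -/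
open Polynomial Function

theorem Polynomial.monic_dickson_one_one_succ (R : Type*) [CommRing R] [Nontrivial R] (m : ℕ) :
    (dickson 1 (1 : R) (m + 1)).Monic ∧ (dickson 1 (1 : R) (m + 1)).natDegree = m + 1 := by
  induction m using Nat.strong_induction_on with
  | _ m ih =>
    match m, ih with
    | 0, _ => simp [monic_X]
    | m + 1, ih =>
      obtain ⟨hm, hdeg⟩ := ih m (by omega)
      have hXm : (X * dickson 1 (1 : R) (m + 1)).Monic := monic_X.mul hm
      have hXdeg : (X * dickson 1 (1 : R) (m + 1)).natDegree = m + 2 := by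
        rw [monic_X.natDegree_mul hm, natDegree_X, hdeg]; omega
      have hlow : (dickson 1 (1 : R) m).natDegree < m + 2 := by
        match m, ih with
        | 0, _ =>
          have h2 : dickson 1 (1 : R) 0 = C 2 := by
            rw [dickson_zero, show (C 2 : R[X]) = 2 from rfl]; norm_num
          rw [h2, natDegree_C]; omega
        | k + 1, ih => rw [(ih k (by omega)).2]; omega
      have hlt : (dickson 1 (1 : R) m).degree < (X * dickson 1 (1 : R) (m + 1)).degree := by
        apply degree_lt_degree; rw [hXdeg]; exact hlow
      rw [dickson_add_two, C_1, one_mul]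
      exact ⟨hXm.sub_of_left hlt, by rw [natDegree_sub_eq_left_of_natDegree_lt (by omega), hXdeg]⟩

theorem Polynomial.dickson_one_one_sub_C {R : Type*} [CommRing R] [Nontrivial R] {m : ℕ}
    (hm : 0 < m) (a : R) : (dickson 1 (1 : R) m - C a).Monic ∧
      (dickson 1 (1 : R) m - C a).natDegree = m := by
  obtain ⟨k, rfl⟩ := Nat.exists_eq_succ_of_ne_zero hm.ne'
  obtain ⟨h1, h2⟩ := monic_dickson_one_one_succ R k
  refine ⟨h1.sub_of_left ?_, by rw [natDegree_sub_C, h2]⟩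
  refine degree_C_le.trans_lt ?_
  rw [degree_eq_natDegree h1.ne_zero, h2]
  exact_mod_cast hm

theorem IsAlgClosed.exists_add_inv_eq {K : Type*} [Field K] [IsAlgClosed K] (x : K) :
    ∃ b : K, b ≠ 0 ∧ b + b⁻¹ = x := by
  have hdeg : (X ^ 2 - C x * X + 1 : K[X]).degree = 2 := by compute_degree!
  obtain ⟨b, hb⟩ := IsAlgClosed.exists_root (X ^ 2 - C x * X + 1 : K[X]) (by rw [hdeg]; decide)
  simp only [IsRoot.def, eval_add, eval_sub, eval_pow, eval_X, eval_mul, eval_C, eval_one] at hb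
  have hb0 : b ≠ 0 := by
    rintro rfl
    simp at hb
  refine ⟨b, hb0, ?_⟩
  field_simp
  linear_combination hb

theorem add_inv_pow_expChar_pow_eq_iff {K : Type*} [Field K] (p : ℕ) [Fact p.Prime] [CharP K p]
    {b : K} (hb : b ≠ 0) (k : ℕ) :
    (b + b⁻¹) ^ p ^ k = b + b⁻¹ ↔ orderOf b ∣ p ^ k - 1 ∨ orderOf b ∣ p ^ k + 1 := by
  have hpos : 0 < p ^ k := pow_pos (Fact.out : p.Prime).pos k
  rw [add_pow_char_pow, inv_pow, add_inv_eq_add_inv_iff (pow_ne_zero _ hb) hb,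
    orderOf_dvd_iff_pow_eq_one, orderOf_dvd_iff_pow_eq_one]
  refine or_congr ?_ ?_
  · conv_lhs => rw [← Nat.sub_add_cancel hpos, pow_succ]
    exact mul_eq_right₀ hb
  · rw [pow_succ, ← mul_eq_one_iff_eq_inv₀ hb]

theorem orderOf_of_pow_two_pow_eq {G : Type*} [Monoid G] {a b : G} {n : ℕ}
    (hab : b ^ 2 ^ n = a) (ha : 2 ∣ orderOf a) : orderOf b = 2 ^ n * orderOf a := by
  induction n generalizing a with
  | zero => simp_all
  | succ n ih =>
    have hsq : (b ^ 2 ^ n) ^ 2 = a := by rw [← hab, ← pow_mul, pow_succ]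
    have h := orderOf_pow' (b ^ 2 ^ n) (two_ne_zero)
    rw [hsq] at h
    rcases (Nat.dvd_prime Nat.prime_two).mp (Nat.gcd_dvd_right (orderOf (b ^ 2 ^ n)) 2) with h1 | h1
    · rw [h1, Nat.div_one] at h
      rw [h] at ha
      have := Nat.dvd_gcd ha dvd_rfl
      omega
    · have h2 := Nat.gcd_dvd_left (orderOf (b ^ 2 ^ n)) 2
      rw [h1] at h2
      rw [ih rfl h2, h, h1, pow_succ, mul_assoc, Nat.mul_div_cancel' h2]

theorem Polynomial.Irreducible.natDegree_dvd_iff_root_pow {p : ℕ} [Fact p.Prime] {g : (ZMod p)[X]}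
    (hg : Irreducible g) {K : Type*} [Field K] [Algebra (ZMod p) K] {x : K}
    (hx : aeval x g = 0) (k : ℕ) : g.natDegree ∣ k ↔ x ^ p ^ k = x := by
  rw [hg.natDegree_dvd_iff_dvd_X_pow_card_pow_sub_X, Nat.card_zmod]
  have hmin := minpoly.eq_of_irreducible hg hx
  have hdvd : g ∣ X ^ p ^ k - X ↔ minpoly (ZMod p) x ∣ X ^ p ^ k - X := by
    rw [← hmin]
    have hu : IsUnit (C g.leadingCoeff⁻¹) :=
      isUnit_C.mpr (inv_ne_zero (leadingCoeff_ne_zero.mpr hg.ne_zero)).isUnit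
    exact (hu.mul_right_dvd).symm
  rw [hdvd, minpoly.dvd_iff]
  simp [sub_eq_zero]

theorem padicValNat_two_pow_two_pow_sub_one {p v : ℕ} (hp : Odd p) (hp1 : p ≠ 1)
    (hv : v = max (padicValNat 2 (p - 1)) (padicValNat 2 (p + 1))) (j : ℕ) :
    padicValNat 2 (p ^ 2 ^ (j + 1) - 1) = v + (j + 1) := by
  have hp' := hp
  obtain ⟨r, hr⟩ := hp'
  have h := padicValNat.pow_two_sub_pow (x := p) (y := 1) (by omega) (by omega) (by omega)
    (n := 2 ^ (j + 1)) (by positivity) (by rw [pow_succ]; exact even_two.mul_left _)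
  rw [one_pow, padicValNat.prime_pow] at h
  have key : ∀ a : ℕ, a ≠ 0 → a % 4 = 2 → padicValNat 2 a = 1 := by
    intro a ha h4
    have h1 : 2 ^ 1 ∣ a := by omega
    have h2 : ¬ 2 ^ 2 ∣ a := by omega
    rw [padicValNat_dvd_iff_le ha] at h1 h2
    omega
  have one_le : ∀ a : ℕ, a ≠ 0 → a % 2 = 0 → 1 ≤ padicValNat 2 a := by
    intro a ha h2
    exact (padicValNat_dvd_iff_le ha).mp (by omega)
  have e1 := one_le (p - 1) (by omega) (by omega)
  have e2 := one_le (p + 1) (by omega) (by omega)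
  have e3 : padicValNat 2 (p - 1) = 1 ∨ padicValNat 2 (p + 1) = 1 := by
    rcases (by omega : (p - 1) % 4 = 2 ∨ (p + 1) % 4 = 2) with h4 | h4
    · exact Or.inl (key _ (by omega) h4)
    · exact Or.inr (key _ (by omega) h4)
  omega

/-- Neither `p ^ 2 ^ j - 1` nor `p ^ 2 ^ j + 1` is divisible by `2 ^ (v + j + 1)`. -/
theorem not_two_pow_dvd_pow_two_pow {p v : ℕ} (hp : Odd p) (hp1 : p ≠ 1)
    (hv : v = max (padicValNat 2 (p - 1)) (padicValNat 2 (p + 1))) (j : ℕ) :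
    ¬ 2 ^ (v + j + 1) ∣ p ^ 2 ^ j - 1 ∧ ¬ 2 ^ (v + j + 1) ∣ p ^ 2 ^ j + 1 := by
  have hp' := hp
  obtain ⟨r, hr⟩ := hp'
  have hlt : 1 < p ^ 2 ^ j := Nat.one_lt_pow (by positivity) (by omega)
  rw [padicValNat_dvd_iff_le (by omega), padicValNat_dvd_iff_le (by omega)]
  cases j with
  | zero =>
    simp only [pow_zero, pow_one]
    omega
  | succ j =>
    rw [padicValNat_two_pow_two_pow_sub_one hp hp1 hv j]
    refine ⟨by omega, fun h => ?_⟩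
    have h4 : 2 ^ 2 ∣ p ^ 2 ^ (j + 1) + 1 :=
      (padicValNat_dvd_iff_le (by omega)).mpr (by omega)
    have hsq : p ^ 2 ^ (j + 1) % 4 = 1 := by
      rw [pow_succ, pow_mul, pow_two]
      obtain ⟨s, hs⟩ := hp.pow (n := 2 ^ j)
      rw [hs, Nat.mul_mod]
      rcases (by omega : (2 * s + 1) % 4 = 1 ∨ (2 * s + 1) % 4 = 3) with h | h <;> rw [h]
    omega

/-- A root of `T_{2^n} - (a + a⁻¹)` in an algebraically closed field has the form `b + b⁻¹` with
`b` of order `2 ^ n` times the order of `a`, if the latter is even. -/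
theorem exists_orderOf_of_dickson_eq {K : Type*} [Field K] [IsAlgClosed K] {a x : K} (ha0 : a ≠ 0)
    (ha : 2 ∣ orderOf a) {n : ℕ} (hx : (dickson 1 (1 : K) (2 ^ n)).eval x = a + a⁻¹) :
    ∃ b : K, b ≠ 0 ∧ b + b⁻¹ = x ∧ orderOf b = 2 ^ n * orderOf a := by
  obtain ⟨b, hb0, rfl⟩ := IsAlgClosed.exists_add_inv_eq x
  rw [dickson_one_one_eval_add_inv _ _ (mul_inv_cancel₀ hb0), inv_pow,
    add_inv_eq_add_inv_iff (pow_ne_zero _ hb0) ha0] at hx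
  rcases hx with h | h
  · exact ⟨b, hb0, rfl, orderOf_of_pow_two_pow_eq h ha⟩
  · refine ⟨b⁻¹, inv_ne_zero hb0, by rw [inv_inv, add_comm], orderOf_of_pow_two_pow_eq ?_ ha⟩
    rw [inv_pow, h, inv_inv]

open UniqueFactorizationMonoid in
theorem Polynomial.splits_of_forall_irreducible_natDegree_eq_one {F : Type*} [Field F] {f : F[X]}
    (hf0 : f ≠ 0) (hf : ∀ g : F[X], Irreducible g → g ∣ f → g.natDegree = 1) : f.Splits := by
  obtain ⟨u, hu⟩ := factors_prod hf0
  rw [← hu]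
  refine (Splits.multisetProd fun g hg => ?_).mul u.isUnit.splits
  exact Splits.of_natDegree_eq_one (hf g (irreducible_of_factor g hg) (dvd_of_mem_factors hg))

/-- Let p be an odd prime, t̄ ∈ F_p with t̄ ≠ −2,
v = max(ν₂(p − 1), ν₂(p + 1)), and D₁ ∈ {p − 1, p + 1} with ν₂(D₁) = v.  Suppose the
preperiod ρ of t̄ under f(x) = T₂(x) = x² − 2 is positive and that in a field E of
order p² there is α ∈ Eˣ with α + α⁻¹ = t̄ of order 2^ρ·d, d odd, d ∣ D₁.  Then for
every n ≥ 1: (i) if n ≤ v − ρ, T_{2^n}(X) − t̄ is a product of 2^n monic linear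
factors; (ii) if n > v − ρ, every monic irreducible factor of T_{2^n}(X) − t̄ has
degree 2^(n−v+ρ); in particular if ρ = v then T_{2^n}(X) − t̄ is irreducible. -/
theorem chebyshev_factorization_two
    (p : ℕ) [hp : Fact p.Prime] (hpodd : Odd p)
    (t : ℤ) (tbar : ZMod p) (ht : tbar = (t : ZMod p)) (htne : tbar ≠ -2)
    (v : ℕ) (hv : v = max (padicValNat 2 (p - 1)) (padicValNat 2 (p + 1)))
    (D₁ : ℕ) (hD₁ : D₁ = p - 1 ∨ D₁ = p + 1) (hD₁v : padicValNat 2 D₁ = v)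
    (ρ : ℕ)
    (hρ : ρ = preperiod (fun x : ZMod p => (dickson 1 (1 : ZMod p) 2).eval x) tbar)
    (hρpos : 0 < ρ)
    (E : Type*) [Field E] [Fintype E] (hE : Fintype.card E = p ^ 2)
    [Algebra (ZMod p) E]
    (α : Eˣ) (hα : (α : E) + ((α⁻¹ : Eˣ) : E) = algebraMap (ZMod p) E tbar)
    (d : ℕ) (hd : Odd d) (hdD₁ : d ∣ D₁) (hord : orderOf α = 2 ^ ρ * d) :
    ∀ n : ℕ, 1 ≤ n →
      (n ≤ v - ρ →
        ∃ r : Fin (2 ^ n) → ZMod p,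
          dickson 1 (1 : ZMod p) (2 ^ n) - C tbar = ∏ i, (X - C (r i))) ∧
      (v - ρ < n →
        ∀ g : (ZMod p)[X], g.Monic → Irreducible g →
          g ∣ dickson 1 (1 : ZMod p) (2 ^ n) - C tbar →
          g.natDegree = 2 ^ (n + ρ - v)) ∧
      (ρ = v → Irreducible (dickson 1 (1 : ZMod p) (2 ^ n) - C tbar)) := by
  have hp1 : p ≠ 1 := hp.out.one_lt.ne'
  have h2ord : 2 ∣ orderOf α := hord ▸ (dvd_pow_self 2 hρpos.ne').mul_right d
  let K := AlgebraicClosure E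
  have : CharP K p := charP_of_injective_algebraMap (algebraMap (ZMod p) K).injective p
  set a : K := algebraMap E K α with ha
  have ha0 : a ≠ 0 := by simp [ha]
  have horda : orderOf a = 2 ^ ρ * d := by
    rw [← hord, ← orderOf_units]
    exact orderOf_injective (algebraMap E K : E →* K) (algebraMap E K).injective _
  have hat : a + a⁻¹ = algebraMap (ZMod p) K tbar := by
    rw [IsScalarTower.algebraMap_apply (ZMod p) E K, ← hα, map_add, ha, Units.val_inv_eq_inv_val,
      map_inv₀]
  intro n hn
  have hmonic := dickson_one_one_sub_C (R := ZMod p) (m := 2 ^ n) (by positivity) tbar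
  have hdegree : ∀ g : (ZMod p)[X], Irreducible g →
      g ∣ dickson 1 (1 : ZMod p) (2 ^ n) - C tbar → ∀ k : ℕ, g.natDegree ∣ k ↔
        2 ^ (n + ρ) * d ∣ p ^ k - 1 ∨ 2 ^ (n + ρ) * d ∣ p ^ k + 1 := by
    intro g hg hdvd k
    obtain ⟨x, hx⟩ := IsAlgClosed.exists_aeval_eq_zero K g (degree_pos_of_irreducible hg).ne'
    have hx' : (dickson 1 (1 : K) (2 ^ n)).eval x = a + a⁻¹ := by
      have h0 := aeval_eq_zero_of_dvd_aeval_eq_zero hdvd hx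
      rw [map_sub, aeval_C, sub_eq_zero, aeval_def, ← eval_map, map_dickson, map_one] at h0
      rw [h0, hat]
    obtain ⟨b, hb0, rfl, hb⟩ :=
      exists_orderOf_of_dickson_eq ha0 (by rw [horda, ← hord]; exact h2ord) hx'
    rw [Polynomial.Irreducible.natDegree_dvd_iff_root_pow hg hx,
      add_inv_pow_expChar_pow_eq_iff p hb0, hb, horda, ← mul_assoc, ← pow_add]
  have hcop : ∀ N : ℕ, Nat.Coprime (2 ^ N) d := fun N =>
    Nat.Coprime.pow_left N (Nat.coprime_two_left.mpr hd)
  have hsplit : n + ρ ≤ v → ∀ g : (ZMod p)[X], Irreducible g →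
      g ∣ dickson 1 (1 : ZMod p) (2 ^ n) - C tbar → g.natDegree = 1 := by
    intro hle g hg hdvd
    have hD0 : D₁ ≠ 0 := by have := hp.out.one_lt; omega
    have hD : 2 ^ (n + ρ) * d ∣ D₁ := (hcop _).mul_dvd_of_dvd_of_dvd
      ((padicValNat_dvd_iff_le hD0).mpr (by omega)) hdD₁
    refine Nat.dvd_one.mp ((hdegree g hg hdvd 1).mpr ?_)
    rw [pow_one]
    rcases hD₁ with rfl | rfl
    · exact Or.inl hD
    · exact Or.inr hD
  have hlarge : v - ρ < n → ∀ g : (ZMod p)[X], Irreducible g →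
      g ∣ dickson 1 (1 : ZMod p) (2 ^ n) - C tbar → g.natDegree = 2 ^ (n + ρ - v) := by
    intro hlt g hg hdvd
    obtain ⟨j, hj⟩ : ∃ j, n + ρ = v + j + 1 := ⟨n + ρ - v - 1, by omega⟩
    rw [show n + ρ - v = j + 1 by omega]
    have hlt1 : 1 < p ^ 2 ^ (j + 1) := Nat.one_lt_pow (by positivity) hp.out.one_lt
    have hdp : d ∣ p ^ 2 ^ (j + 1) - 1 := by
      have hDsq : D₁ ∣ p ^ 2 - 1 := by
        rw [show p ^ 2 - 1 = (p + 1) * (p - 1) from Nat.sq_sub_sq p 1]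
        rcases hD₁ with rfl | rfl
        · exact dvd_mul_left _ _
        · exact dvd_mul_right _ _
      have hpow : p ^ 2 - 1 ∣ p ^ 2 ^ (j + 1) - 1 := by
        have h := Nat.sub_dvd_pow_sub_pow (p ^ 2) 1 (2 ^ j)
        rwa [one_pow, ← pow_mul, ← pow_succ'] at h
      exact hdD₁.trans (hDsq.trans hpow)
    have hup : g.natDegree ∣ 2 ^ (j + 1) := by
      refine (hdegree g hg hdvd _).mpr (Or.inl ((hcop _).mul_dvd_of_dvd_of_dvd ?_ hdp))
      rw [padicValNat_dvd_iff_le (by omega), padicValNat_two_pow_two_pow_sub_one hpodd hp1 hv]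
      omega
    have hlow : ¬ g.natDegree ∣ 2 ^ j := by
      rw [hdegree g hg hdvd, hj]
      obtain ⟨h1, h2⟩ := not_two_pow_dvd_pow_two_pow hpodd hp1 hv j
      rintro (h | h)
      · exact h1 ((dvd_mul_right _ _).trans h)
      · exact h2 ((dvd_mul_right _ _).trans h)
    exact Nat.eq_prime_pow_of_dvd_least_prime_pow Nat.prime_two hlow hup
  refine ⟨fun hle => ?_, fun hlt g _ hg hdvd => hlarge hlt g hg hdvd, fun hρv => ?_⟩
  · have hs := splits_of_forall_irreducible_natDegree_eq_one hmonic.1.ne_zero (hsplit (by omega))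
    have hcard := hs.natDegree_eq_card_roots
    rw [hmonic.2] at hcard
    obtain ⟨l, hl⟩ := Quot.exists_rep (dickson 1 (1 : ZMod p) (2 ^ n) - C tbar).roots
    replace hl : (l : Multiset (ZMod p)) = _ := hl
    have heq := hs.eq_prod_roots_of_monic hmonic.1
    rw [← hl, Multiset.map_coe, Multiset.prod_coe, ← Fin.prod_univ_fun_getElem] at heq
    rw [← hl, Multiset.coe_card] at hcard
    rw [heq, hcard]
    exact ⟨fun i => l[i.1], rfl⟩
  · obtain ⟨g, hg, h, hgh⟩ := WfDvdMonoid.exists_irreducible_factor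
      (not_isUnit_of_natDegree_pos _ (by rw [hmonic.2]; positivity)) hmonic.1.ne_zero
    have hdeg := hlarge (by omega) g hg ⟨h, hgh⟩
    rw [show n + ρ - v = n by omega, ← hmonic.2] at hdeg
    exact (associated_of_dvd_of_natDegree_le ⟨h, hgh⟩ hmonic.1.ne_zero hdeg.ge).irreducible hg
end

section
/- Let ℓ be an odd prime, p a prime with p ≠ ℓ, and t̄ ∈ F_p. Then for every n ≥ 1, the polynomial T_{ℓ^n}(X) − t̄ is reducible in F_p[X] if and only if the polynomial T_ℓ(X) − t̄ has a root in F_p. -/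
open Polynomial

namespace ChebyshevReducible

theorem monic_dickson_one_succ {R : Type*} [CommRing R] [Nontrivial R] (a : R) (n : ℕ) :
    (dickson 1 a (n + 1)).Monic ∧ (dickson 1 a (n + 1)).natDegree = n + 1 ∧
      (dickson 1 a n).natDegree ≤ n := by
  induction n with
  | zero =>
    refine ⟨by simp, by simp, ?_⟩
    have h : dickson 1 a 0 = C (2 : R) := by
      rw [dickson_zero, map_ofNat]
      norm_num
    rw [h, natDegree_C]
  | succ n ih =>
    obtain ⟨hm, hd, hle⟩ := ih
    have hXm : (X * dickson 1 a (n + 1)).Monic := monic_X.mul hm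
    have hXd : (X * dickson 1 a (n + 1)).natDegree = n + 2 := by
      rw [monic_X.natDegree_mul hm, natDegree_X, hd]
      ring
    have hlt : (C a * dickson 1 a n).natDegree < (X * dickson 1 a (n + 1)).natDegree := by
      have := natDegree_C_mul_le a (dickson 1 a n)
      lia
    rw [dickson_add_two]
    exact ⟨hXm.sub_of_left (degree_lt_degree hlt), by
      rw [natDegree_sub_eq_left_of_natDegree_lt hlt, hXd], hd.le⟩

section

variable {R : Type*} [CommRing R] [Nontrivial R]

theorem monic_dickson_one_sub_C (a t : R) {m : ℕ} (hm : 0 < m) :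
    (dickson 1 a m - C t).Monic := by
  obtain ⟨n, rfl⟩ := Nat.exists_eq_succ_of_ne_zero hm.ne'
  obtain ⟨h1, h2, -⟩ := monic_dickson_one_succ a n
  refine h1.sub_of_left (degree_lt_degree ?_)
  rw [natDegree_C]
  lia

theorem natDegree_dickson_one_sub_C (a t : R) {m : ℕ} (hm : 0 < m) :
    (dickson 1 a m - C t).natDegree = m := by
  obtain ⟨n, rfl⟩ := Nat.exists_eq_succ_of_ne_zero hm.ne'
  rw [natDegree_sub_C]
  exact (monic_dickson_one_succ a n).2.1

end

theorem dickson_sub_C_dvd_of_eval_eq_zero {R : Type*} [CommRing R] {k m : ℕ} {t x : R}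
    (hx : (dickson 1 1 k - C t).eval x = 0) :
    dickson 1 1 m - C x ∣ dickson 1 1 (k * m) - C t := by
  obtain ⟨q, hq⟩ := dvd_iff_isRoot.mpr hx
  have h := congrArg (fun r : R[X] ↦ r.comp (dickson 1 1 m)) hq
  simp only [sub_comp, C_comp, mul_comp, X_comp, ← dickson_one_one_mul] at h
  exact ⟨_, h⟩

theorem pow_dvd_orderOf {G : Type*} [Monoid G] {v : G} {ℓ s m : ℕ} (hℓ : ℓ.Prime)
    (h1 : v ^ (ℓ ^ (s + 1) * m) = 1) (h2 : v ^ (ℓ ^ s * m) ≠ 1) :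
    ℓ ^ (s + 1) ∣ orderOf v := by
  obtain ⟨k, hk⟩ := orderOf_dvd_of_pow_eq_one h1
  have hℓk : ¬ ℓ ∣ k := by
    rintro ⟨j, rfl⟩
    refine h2 (orderOf_dvd_iff_pow_eq_one.mp ⟨j, ?_⟩)
    apply Nat.eq_of_mul_eq_mul_left hℓ.pos
    linear_combination hk
  have hcop : Nat.Coprime (ℓ ^ (s + 1)) k :=
    ((Nat.Prime.coprime_iff_not_dvd hℓ).mpr hℓk).pow_left (s + 1)
  exact hcop.dvd_of_dvd_mul_right ⟨m, hk.symm⟩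

/-- Lifting the exponent, for the `ℓ`-part of `p ^ (2 * d) - 1` where `ℓ ∣ p - 1` or
`ℓ ∣ p + 1`. -/
theorem pow_dvd_of_pow_add_dvd_sq_pow_sub_one {ℓ p N a m n d : ℕ} (hℓ : ℓ.Prime) (hodd : Odd ℓ)
    (hN : N + 1 = p ∨ N = p + 1) (hp : 1 < p) (ha : N = ℓ ^ (a + 1) * m) (hm : ¬ ℓ ∣ m)
    (h : ℓ ^ (n + (a + 1)) ∣ (p ^ 2) ^ d - 1) : ℓ ^ n ∣ d := by
  have hℓ2 : ¬ ℓ ∣ 2 := fun h2 ↦ by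
    have := (Nat.prime_dvd_prime_iff_eq hℓ Nat.prime_two).mp h2
    subst this
    exact absurd hodd (by decide)
  have hℓN : ℓ ∣ N := ha ▸ (dvd_pow_self ℓ (Nat.succ_ne_zero a)).mul_right m
  obtain ⟨r, hr, hℓr⟩ : ∃ r, p ^ 2 - 1 = N * r ∧ ¬ ℓ ∣ r := by
    rcases hN with rfl | rfl
    · refine ⟨N + 2, ?_, fun h' ↦ hℓ2 ((Nat.dvd_add_right hℓN).mp h')⟩
      apply Nat.sub_eq_of_eq_add
      ring
    · obtain ⟨q, rfl⟩ := Nat.exists_eq_add_of_lt hp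
      refine ⟨q + 1, ?_, fun h' ↦ hℓ2 ((Nat.dvd_add_right h').mp ?_)⟩
      · apply Nat.sub_eq_of_eq_add
        ring
      · convert hℓN using 1
        ring
  have hval : emultiplicity ℓ (p ^ 2 - 1) = (a + 1 : ℕ) := by
    refine emultiplicity_eq_coe.mpr ⟨⟨m * r, by rw [hr, ha]; ring⟩, ?_⟩
    rw [hr, ha, pow_succ ℓ (a + 1), mul_assoc]
    intro h'
    rcases (Nat.Prime.dvd_mul hℓ).mp (Nat.dvd_of_mul_dvd_mul_left (pow_pos hℓ.pos _) h')
      with h' | h'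
    exacts [hm h', hℓr h']
  have hdvd : ℓ ∣ p ^ 2 - 1 := hr ▸ hℓN.mul_right r
  have hp2 : ¬ ℓ ∣ p ^ 2 := fun h' ↦ hℓ.one_lt.ne' (Nat.dvd_one.mp
    ((Nat.dvd_sub_iff_right (Nat.one_le_pow _ _ (by lia)) h').mp hdvd))
  have hlte := Nat.emultiplicity_pow_sub_pow hℓ hodd hdvd hp2 d
  rw [one_pow, hval] at hlte
  rw [pow_dvd_iff_le_emultiplicity, hlte, Nat.cast_add, add_comm] at h
  rw [pow_dvd_iff_le_emultiplicity]
  exact (ENat.add_le_add_iff_left (ENat.natCast_ne_top _)).mp h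

section

variable {K : Type*} [Field K]

theorem exists_add_inv_eq [IsAlgClosed K] (x : K) : ∃ v : K, v ≠ 0 ∧ v + v⁻¹ = x := by
  obtain ⟨v, hv⟩ := IsAlgClosed.exists_root (X ^ 2 - C x * X + C 1 : K[X]) (by
    have : (X ^ 2 - C x * X + C 1 : K[X]).degree = 2 := by compute_degree!
    rw [this]
    decide)
  have hv : v ^ 2 - x * v + 1 = 0 := by simpa using hv
  have hv0 : v ≠ 0 := by
    rintro rfl
    simp at hv
  refine ⟨v, hv0, ?_⟩
  field_simp
  linear_combination hv

theorem eval_dickson_add_inv {v : K} (hv : v ≠ 0) (n : ℕ) :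
    (dickson 1 1 n).eval (v + v⁻¹) = v ^ n + (v ^ n)⁻¹ := by
  rw [dickson_one_one_eval_add_inv v v⁻¹ (mul_inv_cancel₀ hv), inv_pow]

theorem add_inv_eq_add_inv_iff {v w : K} (hv : v ≠ 0) (hw : w ≠ 0) :
    w + w⁻¹ = v + v⁻¹ ↔ w = v ∨ w = v⁻¹ := by
  constructor
  · intro h
    have h' : (w - v) * (w * v - 1) = 0 := by
      field_simp at h
      linear_combination h
    rcases mul_eq_zero.mp h' with h' | h'
    · exact .inl (sub_eq_zero.mp h')
    · exact .inr (eq_inv_of_mul_eq_one_left (sub_eq_zero.mp h'))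
  · rintro (rfl | rfl)
    · rfl
    · rw [inv_inv, add_comm]

variable {p : ℕ} [Fact p.Prime] [CharP K p]

theorem add_inv_pow_char_pow (v : K) (d : ℕ) :
    (v + v⁻¹) ^ p ^ d = v ^ p ^ d + (v ^ p ^ d)⁻¹ := by
  rw [add_pow_char_pow, inv_pow]

theorem add_inv_pow_char_pow_eq_self_iff {v : K} (hv : v ≠ 0) (d : ℕ) :
    (v + v⁻¹) ^ p ^ d = v + v⁻¹ ↔ v ^ p ^ d = v ∨ v ^ p ^ d = v⁻¹ := by
  rw [add_inv_pow_char_pow, add_inv_eq_add_inv_iff hv (pow_ne_zero _ hv)]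

theorem add_inv_pow_char_eq_self_iff {v : K} (hv : v ≠ 0) :
    (v + v⁻¹) ^ p = v + v⁻¹ ↔ ∃ N, (N + 1 = p ∨ N = p + 1) ∧ v ^ N = 1 := by
  have h := add_inv_pow_char_pow_eq_self_iff (p := p) hv 1
  rw [pow_one] at h
  obtain ⟨q, hq⟩ := Nat.exists_eq_succ_of_ne_zero (Fact.out : p.Prime).ne_zero
  have h1 : v ^ p = v ↔ v ^ q = 1 := by
    rw [hq, pow_succ, mul_eq_right₀ hv]
  have h2 : v ^ p = v⁻¹ ↔ v ^ (p + 1) = 1 := by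
    rw [pow_succ, mul_eq_one_iff_eq_inv₀ hv]
  rw [h, h1, h2]
  constructor
  · rintro (h | h)
    exacts [⟨q, .inl hq.symm, h⟩, ⟨p + 1, .inr rfl, h⟩]
  · rintro ⟨N, hN | rfl, h⟩
    · obtain rfl : N = q := by lia
      exact .inl h
    · exact .inr h

theorem pow_sq_pow_sub_one_eq_one {v : K} (hv : v ≠ 0) {d : ℕ}
    (h : (v + v⁻¹) ^ p ^ d = v + v⁻¹) : v ^ ((p ^ 2) ^ d - 1) = 1 := by
  have h' : v ^ (p ^ 2) ^ d = v := by
    rw [← pow_mul, mul_comm, pow_mul, sq, pow_mul]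
    rcases (add_inv_pow_char_pow_eq_self_iff hv d).mp h with h | h
    · rw [h, h]
    · rw [h, inv_pow, h, inv_inv]
  have hpos : 0 < (p ^ 2) ^ d := pow_pos (pow_pos (Fact.out : p.Prime).pos _) _
  apply mul_right_cancel₀ hv
  rw [← pow_succ, Nat.sub_add_cancel hpos, h', one_mul]

theorem exists_zmod_of_pow_char_eq_self [Algebra (ZMod p) K] {y : K} (hy : y ^ p = y) :
    ∃ x : ZMod p, algebraMap (ZMod p) K x = y := by
  rw [← Subfield.mem_bot_iff_pow_eq_self, ← ZMod.fieldRange_castHom_eq_bot p] at hy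
  obtain ⟨x, rfl⟩ := hy
  exact ⟨x, congrFun (congrArg DFunLike.coe (Subsingleton.elim _ _)) x⟩

end

/-- If `u` has no `ℓ`-th root which is an `N`-th root of unity, then `ℓ ∣ N` and the `ℓ`-part of
the order of `u` is that of `N`. -/
theorem exists_eq_pow_mul_and_pow_ne_one {K : Type*} [Field K] [IsAlgClosed K] {u : K} {ℓ N : ℕ}
    (hℓ : ℓ.Prime) (hN : 0 < N) (hu : u ^ N = 1) (h : ∀ w : K, w ^ N = 1 → w ^ ℓ ≠ u) :
    ∃ a m, N = ℓ ^ (a + 1) * m ∧ ¬ ℓ ∣ m ∧ u ^ (ℓ ^ a * m) ≠ 1 := by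
  obtain ⟨e, m, hm, he⟩ := Nat.exists_eq_pow_mul_and_not_dvd hN.ne' ℓ hℓ.ne_one
  obtain _ | a := e
  · rw [pow_zero, one_mul] at he
    subst he
    exfalso
    have hcop : Nat.Coprime ℓ N := (Nat.Prime.coprime_iff_not_dvd hℓ).mpr hm
    rcases (Nat.one_le_iff_ne_zero.mpr hN.ne').eq_or_lt with rfl | h1
    · rw [pow_one] at hu
      exact h 1 (one_pow _) (by rw [one_pow, hu])
    · obtain ⟨k, -, hk⟩ := Nat.exists_mul_mod_eq_one_of_coprime hcop h1
      refine h (u ^ k) (by rw [pow_right_comm, hu, one_pow]) ?_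
      rw [← pow_mul, mul_comm, pow_eq_pow_mod _ hu, hk, pow_one]
  · refine ⟨a, m, he, hm, fun h1 ↦ ?_⟩
    obtain ⟨w, hw⟩ := IsAlgClosed.exists_pow_nat_eq u hℓ.pos
    refine h w ?_ hw
    rw [he, pow_succ', mul_assoc, pow_mul, hw, h1]

theorem pow_dvd_natDegree_of_irreducible_dvd {ℓ p : ℕ} (hℓ : ℓ.Prime) (hodd : Odd ℓ)
    [Fact p.Prime] {t : ZMod p} {n : ℕ}
    (hroot : ¬ ∃ x : ZMod p, (dickson 1 (1 : ZMod p) ℓ - C t).eval x = 0)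
    {g : (ZMod p)[X]} (hg : Irreducible g) (hdvd : g ∣ dickson 1 1 (ℓ ^ n) - C t) :
    ℓ ^ n ∣ g.natDegree := by
  let K := AlgebraicClosure (ZMod p)
  have : CharP K p := charP_of_injective_algebraMap' (ZMod p) p
  have hp : p.Prime := Fact.out
  have aeval_dickson (m : ℕ) (y : K) :
      aeval y (dickson 1 (1 : ZMod p) m - C t) =
        (dickson 1 1 m).eval y - algebraMap (ZMod p) K t := by
    rw [map_sub, aeval_C, aeval_def, eval₂_eq_eval_map, map_dickson, map_one]
  obtain ⟨x, hx⟩ := IsAlgClosed.exists_aeval_eq_zero K g (degree_pos_of_irreducible hg).ne'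
  obtain ⟨v, hv, rfl⟩ := exists_add_inv_eq x
  set u := v ^ ℓ ^ n with hu
  have hu0 : u ≠ 0 := pow_ne_zero _ hv
  have hut : u + u⁻¹ = algebraMap (ZMod p) K t := by
    have h := aeval_eq_zero_of_dvd_aeval_eq_zero hdvd hx
    rwa [aeval_dickson, eval_dickson_add_inv hv, sub_eq_zero] at h
  have hfrob : (u + u⁻¹) ^ p = u + u⁻¹ := by
    rw [hut, ← map_pow, ZMod.pow_card]
  obtain ⟨N, hN, huN⟩ := (add_inv_pow_char_eq_self_iff hu0).mp hfrob
  have hNpos : 0 < N := by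
    have := hp.two_le
    lia
  obtain ⟨a, m, ha, hm, hne⟩ := exists_eq_pow_mul_and_pow_ne_one hℓ hNpos huN (by
    intro w hwN hw
    have hw0 : w ≠ 0 := by
      rintro rfl
      rw [zero_pow hNpos.ne'] at hwN
      exact zero_ne_one hwN
    obtain ⟨y, hy⟩ := exists_zmod_of_pow_char_eq_self (p := p)
      ((add_inv_pow_char_eq_self_iff hw0).mpr ⟨N, hN, hwN⟩)
    refine hroot ⟨y, (algebraMap (ZMod p) K).injective ?_⟩
    rw [map_zero, ← aeval_algebraMap_apply_eq_algebraMap_eval, hy, aeval_dickson,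
      eval_dickson_add_inv hw0, hw, hut, sub_self])
  have horder : ℓ ^ (n + (a + 1)) ∣ orderOf v := by
    refine pow_dvd_orderOf (s := n + a) (m := m) hℓ ?_ ?_
    · rw [add_assoc, pow_add, mul_assoc, ← ha, pow_mul, huN]
    · rwa [pow_add, mul_assoc, pow_mul]
  have hxd : (v + v⁻¹) ^ p ^ g.natDegree = v + v⁻¹ := by
    have h := aeval_eq_zero_of_dvd_aeval_eq_zero
      (hg.natDegree_dvd_iff_dvd_X_pow_card_pow_sub_X.mp dvd_rfl) hx
    simpa [sub_eq_zero] using h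
  exact pow_dvd_of_pow_add_dvd_sq_pow_sub_one hℓ hodd hN hp.one_lt ha hm
    (horder.trans (orderOf_dvd_of_pow_eq_one (pow_sq_pow_sub_one_eq_one hv hxd)))

end ChebyshevReducible

open ChebyshevReducible in
/-- Let ℓ be an odd prime and p ≠ ℓ a prime, t̄ ∈ F_p.  For every
n ≥ 1, T_{ℓ^n}(X) − t̄ is reducible in F_p[X] if and only if T_ℓ(X) − t̄ has a root in
F_p. -/
theorem chebyshev_reducible_iff_root
    (ℓ p : ℕ) (hℓ : ℓ.Prime) (hℓodd : Odd ℓ) [hp : Fact p.Prime] (hℓp : p ≠ ℓ)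
    (tbar : ZMod p) :
    ∀ n : ℕ, 1 ≤ n →
      (¬ Irreducible (dickson 1 (1 : ZMod p) (ℓ ^ n) - C tbar) ↔
        ∃ x : ZMod p, (dickson 1 (1 : ZMod p) ℓ - C tbar).eval x = 0) := by
  intro n hn
  have hpos : 0 < ℓ ^ n := pow_pos hℓ.pos n
  have hmonic := monic_dickson_one_sub_C (1 : ZMod p) tbar hpos
  have hdeg := natDegree_dickson_one_sub_C (1 : ZMod p) tbar hpos
  constructor
  · contrapose
    intro hroot
    have hunit : ¬ IsUnit (dickson 1 (1 : ZMod p) (ℓ ^ n) - C tbar) := fun h ↦ by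
      rw [natDegree_eq_zero_of_isUnit h] at hdeg
      exact hpos.ne hdeg
    obtain ⟨g, hg, hdvd⟩ := WfDvdMonoid.exists_irreducible_factor hunit hmonic.ne_zero
    have hle := Nat.le_of_dvd hg.natDegree_pos
      (pow_dvd_natDegree_of_irreducible_dvd hℓ hℓodd hroot hg hdvd)
    exact (associated_of_dvd_of_natDegree_le hdvd hmonic.ne_zero (hdeg.trans_le hle)).irreducible hg
  · rintro ⟨x, hx⟩ hirr
    obtain ⟨k, rfl⟩ := Nat.exists_eq_add_of_le' hn
    have hkpos : 0 < ℓ ^ k := pow_pos hℓ.pos k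
    have hdvd := dickson_sub_C_dvd_of_eval_eq_zero (m := ℓ ^ k) hx
    rw [← pow_succ'] at hdvd
    have hkdeg := natDegree_dickson_one_sub_C (1 : ZMod p) x hkpos
    rcases hirr.dvd_iff.mp hdvd with h | h
    · rw [natDegree_eq_zero_of_isUnit h] at hkdeg
      exact hkpos.ne hkdeg
    · rw [natDegree_eq_of_degree_eq (degree_eq_degree_of_associated h), hkdeg] at hdeg
      exact (Nat.pow_lt_pow_succ hℓ.one_lt).ne hdeg
end

section
/- Let ℓ be an odd prime, n ≥ 1, and t ∈ ℂ. Let f = T_{ℓ^n} − t ∈ ℂ[X], a monic polynomial of degree ℓ^n, and let r : Fin(ℓ^n) → ℂ be any enumeration of its roots with multiplicity, i.e., f = ∏_{i} (X − r(i)). Then ∏_{i < j} (r(i) − r(j))² = ℓ^(n·ℓ^n) · (4 − t²)^((ℓ^n − 1)/2). (Equivalently, the discriminant of T_{ℓ^n}(X) − t equals ℓ^(n·ℓ^n)(4 − t²)^((ℓ^n−1)/2).) -/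
open Polynomial

namespace Polynomial.Chebyshev

variable {R : Type*} [CommRing R]

theorem derivative_C_eq_mul_S (n : ℕ) :
    derivative (Chebyshev.C R n) = n * S R (n - 1) := by
  induction n using Nat.twoStepInduction with
  | zero => simp
  | one => simp
  | more n h₀ h₁ =>
    have hC : Chebyshev.C R (n + 1) = S R (n + 1) - S R (n - 1) := by
      linear_combination S_add_one R n - S_eq_X_mul_S_add_C R n
    have hS := S_add_one R n
    push_cast at h₁ ⊢
    rw [C_add_two, derivative_sub, derivative_mul, derivative_X, h₀, h₁, hC,
      show (n : ℤ) + 2 - 1 = n + 1 by ring, show (n : ℤ) + 1 - 1 = n by ring]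
    linear_combination (-(n : R[X]) - 1) * hS

theorem S_monic_and_natDegree [Nontrivial R] (n : ℕ) :
    (S R n).Monic ∧ (S R n).natDegree = n := by
  induction n using Nat.twoStepInduction with
  | zero => simp
  | one => simp
  | more n h₀ h₁ =>
    have hm : (X * S R ((n + 1 : ℕ) : ℤ)).Monic := monic_X.mul h₁.1
    have hd : (X * S R ((n + 1 : ℕ) : ℤ)).natDegree = n + 2 := by
      rw [natDegree_X_mul h₁.1.ne_zero, h₁.2]
    have hlt : (S R (n : ℤ)).natDegree < (X * S R ((n + 1 : ℕ) : ℤ)).natDegree := by omega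
    have hS : S R ((n + 2 : ℕ) : ℤ) = X * S R ((n + 1 : ℕ) : ℤ) - S R n := by
      push_cast
      exact S_add_two R n
    rw [hS]
    exact ⟨hm.sub_of_left (degree_lt_degree hlt),
      (natDegree_sub_eq_left_of_natDegree_lt hlt).trans hd⟩

theorem degree_S_sub_one_lt [Nontrivial R] (k : ℕ) :
    (S R (k - 1)).degree < (S R k).degree := by
  rw [degree_eq_natDegree (S_monic_and_natDegree k).1.ne_zero, (S_monic_and_natDegree k).2]
  cases k with
  | zero => simp
  | succ k =>
    push_cast
    rw [add_sub_cancel_right, degree_eq_natDegree (S_monic_and_natDegree k).1.ne_zero,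
      (S_monic_and_natDegree k).2]
    exact_mod_cast k.lt_succ_self

theorem S_two_mul_and_S_two_mul_add_one (k : ℕ) :
    S R (2 * k) = S R k ^ 2 - S R (k - 1) ^ 2 ∧
      S R (2 * k + 1) = S R k * (S R (k + 1) - S R (k - 1)) := by
  induction k with
  | zero => simp
  | succ k ih =>
    have h₁ := S_add_one R k
    have h₂ := S_add_two R k
    have h₃ := S_add_two R (2 * k)
    have h₄ := S_add_one R (2 * k + 2)
    rw [show (2 * k + 2 - 1 : ℤ) = 2 * k + 1 by ring] at h₄
    push_cast
    rw [show (2 * (k + 1) : ℤ) = 2 * k + 2 by ring, show (k + 1 + 1 : ℤ) = k + 2 by ring,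
      add_sub_cancel_right]
    have h₅ : S R (2 * k + 2) = S R (k + 1) ^ 2 - S R k ^ 2 := by
      rw [h₃, ih.1, ih.2]
      linear_combination (S R (k - 1) - S R (k + 1)) * h₁
    refine ⟨h₅, ?_⟩
    rw [h₄, h₅, ih.2, h₂]
    linear_combination S R k * h₁

theorem C_two_mul_add_one (k : ℕ) :
    Chebyshev.C R (2 * k + 1) = 2 + (X - 2) * (S R k + S R (k - 1)) ^ 2 ∧
      Chebyshev.C R (2 * k + 1) = -2 + (X + 2) * (S R k - S R (k - 1)) ^ 2 := by
  obtain ⟨h₁, h₂⟩ := S_two_mul_and_S_two_mul_add_one (R := R) k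
  have h₃ := S_eq_X_mul_S_add_C R (2 * k)
  have h₄ := S_sq_add_S_sq R (k - 1)
  have h₅ := S_add_one R k
  rw [sub_add_cancel] at h₄
  rw [h₁, h₂, h₅] at h₃
  exact ⟨by linear_combination -h₃ + 2 * h₄, by linear_combination -h₃ - 2 * h₄⟩

end Polynomial.Chebyshev

theorem Polynomial.Monic.prod_eval_eq_of_eval_roots {K ι : Type*} [Field K] [IsAlgClosed K]
    [Fintype ι] {P : K[X]} (hP : P.Monic) (r : ι → K) (c : K)
    (hc : ∀ q, P.IsRoot q → (∏ i, (X - C (r i))).eval q = c) :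
    ∏ i, P.eval (r i) = (-1) ^ (Fintype.card ι * P.natDegree) * c ^ P.natDegree := by
  have hs := IsAlgClosed.splits P
  have heval (i : ι) : P.eval (r i) = (P.roots.map fun q => r i - q).prod :=
    hs.eval_eq_prod_roots_of_monic hP (r i)
  have hprod (q : K) (hq : q ∈ P.roots) :
      ∏ i, (r i - q) = (-1) ^ Fintype.card ι * c := by
    rw [← hc q (isRoot_of_mem_roots hq), eval_prod, ← Finset.card_univ, ← Finset.prod_const,
      ← Finset.prod_mul_distrib]
    simp
  simp_rw [heval]
  rw [← Multiset.prod_map_prod, Multiset.map_congr rfl hprod, Multiset.map_const',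
    Multiset.prod_replicate, ← hs.natDegree_eq_card_roots, mul_pow, pow_mul]

theorem Finset.prod_sub_sq_eq_prod_eval_derivative {R : Type*} [CommRing R] {N : ℕ}
    (r : Fin N → R) :
    ∏ ij ∈ Finset.univ.filter (fun ij : Fin N × Fin N => ij.1 < ij.2), (r ij.1 - r ij.2) ^ 2 =
      (-1) ^ (N * (N - 1) / 2) * ∏ i, (derivative (∏ j, (X - C (r j)))).eval (r i) := by
  have hd (i : Fin N) : (derivative (∏ j, (X - C (r j)))).eval (r i) =
      ∏ j ∈ {i}ᶜ, (r i - r j) := by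
    rw [derivative_prod_finset, eval_finsetSum, Finset.sum_eq_single i]
    · simp [eval_prod, Finset.compl_eq_univ_sdiff, Finset.sdiff_singleton_eq_erase]
    · intro j _ hj
      simp [eval_prod, Finset.prod_eq_zero (Finset.mem_erase.2 ⟨hj.symm, Finset.mem_univ i⟩)]
    · simp
  have hpairs (f : Fin N → Fin N → R) :
      ∏ ij ∈ Finset.univ.filter (fun ij : Fin N × Fin N => ij.1 < ij.2), f ij.1 ij.2 =
        ∏ i, ∏ j ∈ Finset.Ioi i, f i j := by
    rw [Finset.prod_filter, Fintype.prod_prod_type]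
    refine Finset.prod_congr rfl fun i _ => ?_
    rw [← Finset.prod_filter]
    congr 1
    ext j
    simp
  have hcard : ∏ i : Fin N, ∏ _j ∈ Finset.Ioi i, (-1 : R) = (-1) ^ (N * (N - 1) / 2) := by
    simp_rw [Finset.prod_const, Fin.card_Ioi]
    rw [Finset.prod_pow_eq_pow_sum, Fin.sum_univ_eq_sum_range (fun i => N - 1 - i),
      Finset.sum_range_reflect (fun i => i), Finset.sum_range_id]
  simp_rw [hd]
  rw [← Finset.prod_prod_Ioi_mul_eq_prod_prod_off_diag, ← hcard,
    hpairs (fun i j => (r i - r j) ^ 2), ← Finset.prod_mul_distrib]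
  refine Finset.prod_congr rfl fun i _ => ?_
  rw [← Finset.prod_mul_distrib]
  exact Finset.prod_congr rfl fun j _ => by ring

theorem prod_sub_sq_of_dickson_sub_C {K : Type*} [Field K] [IsAlgClosed K] (k : ℕ) (t : K)
    (r : Fin (2 * k + 1) → K)
    (hr : dickson 1 (1 : K) (2 * k + 1) - C t = ∏ i, (X - C (r i))) :
    ∏ ij ∈ Finset.univ.filter
        (fun ij : Fin (2 * k + 1) × Fin (2 * k + 1) => ij.1 < ij.2), (r ij.1 - r ij.2) ^ 2 =
      ((2 * k + 1 : ℕ) : K) ^ (2 * k + 1) * (4 - t ^ 2) ^ k := by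
  obtain ⟨hSm, hSd⟩ := Chebyshev.S_monic_and_natDegree (R := K) k
  have hlt := Chebyshev.degree_S_sub_one_lt (R := K) k
  obtain ⟨hQ, hP⟩ := Chebyshev.C_two_mul_add_one (R := K) k
  have hr' : Chebyshev.C K (2 * k + 1) - C t = ∏ i, (X - C (r i)) := by
    rw [← hr, dickson_one_one_eq_chebyshev_C]
    push_cast
    rfl
  have hprodQ := (hSm.add_of_left hlt).prod_eval_eq_of_eval_roots r (2 - t) fun q hq => by
    rw [← hr', hQ]
    simp only [IsRoot.def] at hq
    simp [-eval_add, eval_sub, eval_add (p := (2 : K[X])), hq]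
  have hprodP := (hSm.sub_of_left hlt).prod_eval_eq_of_eval_roots r (-2 - t) fun q hq => by
    rw [← hr', hP]
    simp only [IsRoot.def] at hq
    simp [-eval_sub, eval_sub (q := C t), hq]
  rw [natDegree_add_eq_left_of_degree_lt hlt, hSd, Fintype.card_fin] at hprodQ
  rw [natDegree_eq_of_degree_eq (degree_sub_eq_left_of_degree_lt hlt), hSd, Fintype.card_fin] at hprodP
  have hderiv (x : K) : (derivative (∏ j, (X - C (r j)))).eval x =
      ((2 * k + 1 : ℕ) : K) * ((Chebyshev.S K k + Chebyshev.S K (k - 1)).eval x *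
        (Chebyshev.S K k - Chebyshev.S K (k - 1)).eval x) := by
    have h := Chebyshev.derivative_C_eq_mul_S (R := K) (2 * k + 1)
    rw [← hr', derivative_sub, derivative_C, sub_zero, ← eval_mul, ← sq_sub_sq,
      ← (Chebyshev.S_two_mul_and_S_two_mul_add_one (R := K) k).1]
    push_cast at h ⊢
    rw [h, add_sub_cancel_right]
    simp
  rw [Finset.prod_sub_sq_eq_prod_eval_derivative]
  simp_rw [hderiv]
  rw [Finset.prod_mul_distrib, Finset.prod_mul_distrib, hprodQ, hprodP, Finset.prod_const,
    Finset.card_univ, Fintype.card_fin, add_tsub_cancel_right,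
    show (2 * k + 1) * (2 * k) / 2 = (2 * k + 1) * k by
      rw [mul_left_comm, Nat.mul_div_cancel_left _ two_pos],
    pow_mul, pow_succ (-1 : K), pow_mul (-1 : K) 2 k]
  simp only [neg_one_sq, one_pow, one_mul]
  rw [show (4 - t ^ 2 : K) = -1 * (-1 * (2 - t) * (-1 * (-2 - t))) by ring]
  simp only [mul_pow]
  ring

/-- Let ℓ be an odd prime, n ≥ 1, t ∈ ℂ, and let r enumerate the
roots (with multiplicity) of the monic polynomial T_{ℓ^n} − t ∈ ℂ[X].  Then
∏_{i<j} (r i − r j)² = ℓ^(n·ℓ^n)·(4 − t²)^((ℓ^n − 1)/2), i.e. the discriminant of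
T_{ℓ^n}(X) − t equals ℓ^(n·ℓ^n)(4 − t²)^((ℓ^n−1)/2). -/
theorem chebyshev_discriminant_odd
    (ℓ : ℕ) (hℓ : ℓ.Prime) (hℓodd : Odd ℓ) (n : ℕ) (hn : 1 ≤ n) (t : ℂ)
    (r : Fin (ℓ ^ n) → ℂ)
    (hr : dickson 1 (1 : ℂ) (ℓ ^ n) - C t = ∏ i, (X - C (r i))) :
    ∏ ij ∈ Finset.univ.filter (fun ij : Fin (ℓ ^ n) × Fin (ℓ ^ n) => ij.1 < ij.2),
        (r ij.1 - r ij.2) ^ 2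
      = (ℓ : ℂ) ^ (n * ℓ ^ n) * (4 - t ^ 2) ^ ((ℓ ^ n - 1) / 2) := by
  rw [pow_mul, ← Nat.cast_pow]
  obtain ⟨k, hk⟩ := hℓodd.pow (n := n)
  generalize ℓ ^ n = N at *
  subst hk
  rw [prod_sub_sq_of_dickson_sub_C k t r hr, add_tsub_cancel_right,
    Nat.mul_div_cancel_left _ two_pos]
end

section
/- Let ℓ be an odd prime and t ∈ ℤ with ℓ ∣ t and ℓ² ∤ t. Then for every n ≥ 1, the polynomial T_{ℓ^n}(X) − t ∈ ℤ[X] is Eisenstein at the prime ℓ (i.e., it is monic, all non-leading coefficients are divisible by ℓ, and the constant coefficient is not divisible by ℓ²); in particular it is irreducible over ℚ. -/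
open Polynomial

namespace Polynomial

theorem natDegree_dickson_le {R : Type*} [CommRing R] (k : ℕ) (a : R) :
    ∀ n : ℕ, (dickson k a n).natDegree ≤ n
  | 0 => by
    have h : dickson k a 0 = C (3 - k : R) := by simp [C_ofNat]
    rw [h, natDegree_C]
  | 1 => by simpa using natDegree_X_le
  | n + 2 => by
    rw [dickson_add_two]
    refine (natDegree_sub_le _ _).trans (max_le ?_ ?_)
    · refine natDegree_mul_le.trans ?_
      have h₁ := natDegree_dickson_le k a (n + 1)
      have h₂ := natDegree_X_le (R := R)
      lia
    · exact (natDegree_C_mul_le _ _).trans ((natDegree_dickson_le k a n).trans (by lia))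

theorem isMonicOfDegree_dickson {R : Type*} [CommRing R] [Nontrivial R] (k : ℕ) (a : R) (n : ℕ)
    (hn : n ≠ 0) : IsMonicOfDegree (dickson k a n) n := by
  obtain ⟨n, rfl⟩ := Nat.exists_eq_succ_of_ne_zero hn
  clear hn
  induction n with
  | zero => simpa using isMonicOfDegree_X R
  | succ n ih =>
    rw [Nat.succ_eq_add_one, dickson_add_two]
    refine IsMonicOfDegree.sub ?_ ?_
    · simpa [add_comm] using (isMonicOfDegree_X R).mul ih
    · exact (natDegree_C_mul_le _ _).trans_lt
        ((natDegree_dickson_le k a n).trans_lt (by lia))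

theorem coeff_zero_dickson_of_odd {R : Type*} [CommRing R] (k : ℕ) (a : R) {n : ℕ} (hn : Odd n) :
    (dickson k a n).coeff 0 = 0 := by
  obtain ⟨m, rfl⟩ := hn
  induction m with
  | zero => simp
  | succ m ih =>
    rw [show 2 * (m + 1) + 1 = 2 * m + 1 + 2 by ring, dickson_add_two]
    simp [ih]

theorem dickson_one_one_charP_pow {R : Type*} [CommRing R] (p : ℕ) [Fact p.Prime] [CharP R p]
    (n : ℕ) : dickson 1 (1 : R) (p ^ n) = X ^ p ^ n := by
  induction n with
  | zero => simp
  | succ n ih =>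
    rw [pow_succ, dickson_one_one_mul, dickson_one_one_charP R p, ih, X_pow_comp, ← pow_mul, mul_comm]

end Polynomial

/-- Let ℓ be an odd prime and t ∈ ℤ with ℓ ∣ t and ℓ² ∤ t.  Then for
every n ≥ 1 the polynomial T_{ℓ^n}(X) − t ∈ ℤ[X] is Eisenstein at the prime ideal (ℓ),
and in particular irreducible over ℚ. -/
theorem chebyshev_eisenstein
    (ℓ : ℕ) (hℓ : ℓ.Prime) (hℓodd : Odd ℓ)
    (t : ℤ) (h1 : (ℓ : ℤ) ∣ t) (h2 : ¬ (ℓ : ℤ) ^ 2 ∣ t) :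
    ∀ n : ℕ, 1 ≤ n →
      (dickson 1 (1 : ℤ) (ℓ ^ n) - C t).IsEisensteinAt
        (Ideal.span {(ℓ : ℤ)}) ∧
      Irreducible (dickson 1 (1 : ℚ) (ℓ ^ n) - C (t : ℚ)) := by
  intro n _
  have : Fact ℓ.Prime := ⟨hℓ⟩
  have hpos : 0 < ℓ ^ n := pow_pos hℓ.pos n
  have hmonic : IsMonicOfDegree (dickson 1 (1 : ℤ) (ℓ ^ n) - C t) (ℓ ^ n) :=
    (isMonicOfDegree_dickson 1 1 _ hpos.ne').sub (by simpa using hpos)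
  have hprime : (Ideal.span {(ℓ : ℤ)}).IsPrime :=
    (Ideal.span_singleton_prime (by exact_mod_cast hℓ.ne_zero)).2 (Nat.prime_iff_prime_int.1 hℓ)
  have heis : (dickson 1 (1 : ℤ) (ℓ ^ n) - C t).IsEisensteinAt (Ideal.span {(ℓ : ℤ)}) := by
    refine hmonic.monic.isEisensteinAt_of_mem_of_notMem hprime.ne_top (fun {i} hi => ?_) ?_
    · rw [hmonic.natDegree_eq] at hi
      have hmap : (dickson 1 (1 : ℤ) (ℓ ^ n) - C t).map (Int.castRingHom (ZMod ℓ)) =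
          X ^ ℓ ^ n := by
        rw [Polynomial.map_sub, map_dickson, map_one, dickson_one_one_charP_pow, map_C,
          eq_intCast, (ZMod.intCast_zmod_eq_zero_iff_dvd t ℓ).2 h1, C_0, sub_zero]
      rw [Ideal.mem_span_singleton, ← ZMod.intCast_zmod_eq_zero_iff_dvd, ← eq_intCast
        (Int.castRingHom (ZMod ℓ)), ← coeff_map, hmap, coeff_X_pow, if_neg hi.ne]
    · rwa [Ideal.span_singleton_pow, Ideal.mem_span_singleton, coeff_sub,
        coeff_zero_dickson_of_odd 1 1 hℓodd.pow, coeff_C_zero, zero_sub, dvd_neg]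
  refine ⟨heis, ?_⟩
  have hirr := (IsPrimitive.Int.irreducible_iff_irreducible_map_cast hmonic.monic.isPrimitive).1
    (heis.irreducible hprime hmonic.monic.isPrimitive (hpos.trans_eq hmonic.natDegree_eq.symm))
  simpa [map_dickson] using hirr
end
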